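/- arXiv:2310.20402 — 8 statements merged into one kernel-verified Lean document; each statement's English description precedes it below -/
import Mathlib

section
/- Let μ and ν be finite nonnegative Borel measures on ℝ^d with finite first moments. If there exists a moment-preserving unnormalized kernel q transporting μ to ν, then for every support function f : ℝ^d → ℝ one has ∫ f dμ ≤ ∫ f dν. -/
open MeasureTheory Filter
open scoped ENNReal NNReal

noncomputable section

/-- `ℝ^d` with the Euclidean norm. -/
abbrev Ed (d : ℕ) := EuclideanSpace ℝ (Fin d)

/-- A support function on `ℝ^d`: convex and positively 1-homogeneous. -/
def IsSupportFunction {d : ℕ} (f : Ed d → ℝ) : Prop :=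
  ConvexOn ℝ Set.univ f ∧ ∀ (t : ℝ), 0 ≤ t → ∀ x : Ed d, f (t • x) = t * f x

/-- An unnormalized kernel: a family of finite nonnegative Borel measures,
Borel measurable in the first argument. -/
def IsUKernel {d : ℕ} (q : Ed d → Measure (Ed d)) : Prop :=
  (∀ x, IsFiniteMeasure (q x)) ∧
  ∀ A : Set (Ed d), MeasurableSet A → Measurable fun x => q x A

/-- The kernel `q` transports `μ` to `ν`. -/
def Transports {d : ℕ} (q : Ed d → Measure (Ed d)) (μ ν : Measure (Ed d)) : Prop :=
  ∀ A : Set (Ed d), MeasurableSet A → ∫⁻ x, q x A ∂μ = ν A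

/-- The kernel `q` is moment-preserving (w.r.t. the source measure `μ`):
`∫ y q^x(dy) = x` for `μ`-a.e. `x`. -/
def MomentPreserving {d : ℕ} (q : Ed d → Measure (Ed d)) (μ : Measure (Ed d)) : Prop :=
  ∀ᵐ x ∂μ, ∫ y, y ∂(q x) = x

/-- `μ ≼phc ν`: ordering by integration of support functions. -/
def PHC {d : ℕ} (μ ν : Measure (Ed d)) : Prop :=
  ∀ f : Ed d → ℝ, IsSupportFunction f → ∫ x, f x ∂μ ≤ ∫ x, f x ∂ν

/-- Positively 1-homogeneous real functions. -/
def PosHomogeneous {d : ℕ} (f : Ed d → ℝ) : Prop :=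
  ∀ (t : ℝ), 0 ≤ t → ∀ x : Ed d, f (t • x) = t * f x

/-- `μ ≡ph ν`: equality of integrals of all positively 1-homogeneous Borel functions
bounded on the unit sphere. -/
def EqPH {d : ℕ} (μ ν : Measure (Ed d)) : Prop :=
  ∀ f : Ed d → ℝ, Measurable f → PosHomogeneous f →
    (∃ C : ℝ, ∀ x : Ed d, ‖x‖ = 1 → |f x| ≤ C) →
    ∫ x, f x ∂μ = ∫ x, f x ∂ν

namespace IsSupportFunction

variable {d : ℕ} {f : Ed d → ℝ}

theorem continuous (hf : IsSupportFunction f) : Continuous f :=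
  hf.1.locallyLipschitz.continuous

theorem exists_norm_le (hf : IsSupportFunction f) : ∃ C : ℝ, ∀ x, ‖f x‖ ≤ C * ‖x‖ := by
  obtain ⟨C, hC⟩ := (isCompact_sphere (0 : Ed d) 1).exists_bound_of_continuousOn
    hf.continuous.continuousOn
  refine ⟨C, fun x => ?_⟩
  rcases eq_or_ne x 0 with rfl | hx
  · have h0 := hf.2 0 le_rfl 0
    simp_all
  · have hx' : ‖x‖ ≠ 0 := norm_ne_zero_iff.2 hx
    have h := hC (‖x‖⁻¹ • x) (by simp [norm_smul, hx'])
    have hfx : f x = ‖x‖ * f (‖x‖⁻¹ • x) := by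
      rw [← hf.2 _ (norm_nonneg x), smul_inv_smul₀ hx']
    rw [hfx, norm_mul, norm_norm, mul_comm]
    gcongr

theorem integrable (hf : IsSupportFunction f) {μ : Measure (Ed d)}
    (hμ : Integrable (fun x => ‖x‖) μ) : Integrable f μ := by
  obtain ⟨C, hC⟩ := hf.exists_norm_le
  exact (hμ.const_mul C).mono' hf.continuous.aestronglyMeasurable (ae_of_all _ hC)

/-- Jensen's inequality for support functions: by homogeneity the measure need not be
normalized. -/
theorem map_integral_le (hf : IsSupportFunction f) {μ : Measure (Ed d)} [IsFiniteMeasure μ]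
    (hμ : Integrable (fun x => ‖x‖) μ) : f (∫ y, y ∂μ) ≤ ∫ y, f y ∂μ := by
  rcases eq_or_ne μ 0 with rfl | h0
  · have h := hf.2 0 le_rfl 0
    simp_all
  · have : NeZero μ := ⟨h0⟩
    have hid : Integrable (fun y : Ed d => y) μ :=
      (integrable_norm_iff aestronglyMeasurable_id).1 hμ
    have h := hf.1.map_average_le hf.continuous.continuousOn isClosed_univ
      (ae_of_all _ fun _ => Set.mem_univ _) hid (hf.integrable hμ)
    rw [← measure_smul_average μ (fun y : Ed d => y), ← measure_smul_average μ f,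
      hf.2 _ measureReal_nonneg, smul_eq_mul]
    gcongr

end IsSupportFunction

/-- If there is a moment-preserving unnormalized kernel transporting `μ` to `ν`, then
`∫ f dμ ≤ ∫ f dν` for every support function `f`. -/
theorem integral_le_of_momentPreserving_kernel {d : ℕ}
    (μ ν : Measure (Ed d)) [IsFiniteMeasure μ] [IsFiniteMeasure ν]
    (hμ : Integrable (fun x => ‖x‖) μ) (hν : Integrable (fun x => ‖x‖) ν)
    (q : Ed d → Measure (Ed d)) (hq : IsUKernel q)
    (hqt : Transports q μ ν) (hqm : MomentPreserving q μ) :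
    ∀ f : Ed d → ℝ, IsSupportFunction f → ∫ x, f x ∂μ ≤ ∫ x, f x ∂ν := by
  intro f hf
  have hqmeas : Measurable q := Measure.measurable_of_measurable_coe q hq.2
  let κ : ProbabilityTheory.Kernel (Ed d) (Ed d) := ⟨q, hqmeas⟩
  let η : ProbabilityTheory.Kernel Unit (Ed d) := ProbabilityTheory.Kernel.const Unit μ
  have hη : η () = μ := ProbabilityTheory.Kernel.const_apply _ _
  have hbind : ν = (κ.comp η) () := by
    ext A hA
    rw [ProbabilityTheory.Kernel.comp_apply' _ _ _ hA, hη]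
    exact (hqt A hA).symm
  have hfν : Integrable f ν := hf.integrable hν
  rw [hbind] at hfν hν ⊢
  have hint : Integrable (fun x => ∫ y, f y ∂q x) μ := hη ▸ hfν.integral_comp
  have hnorm : ∀ᵐ x ∂μ, Integrable (fun y => ‖y‖) (q x) := hη ▸ hν.ae_of_comp
  rw [ProbabilityTheory.Kernel.integral_comp hfν, hη]
  refine integral_mono_ae (hf.integrable hμ) hint ?_
  filter_upwards [hqm, hnorm] with x hx hxn
  have := hq.1 x
  have hle := hf.map_integral_le hxn
  rw [hx] at hle
  exact hle
end
end

section
/- Let f : ℝ^d \ {0} → ℝ be a positively 1-homogeneous function of class C², extended positively 1-homogeneously (with f(0) = 0). Then there exists a constant c > 0 such that the function g(x) := f(x) + c|x| is convex (hence a support function). -/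
open MeasureTheory Filter
open scoped ENNReal NNReal

noncomputable section

section PositivelyHomogeneous

variable {E : Type*}

/-- Euler's identity for positively 1-homogeneous functions. -/
theorem fderiv_apply_self_of_posHomogeneous [NormedAddCommGroup E] [NormedSpace ℝ E] {f : E → ℝ}
    (hhom : ∀ t : ℝ, 0 ≤ t → ∀ x, f (t • x) = t * f x) {x : E} (hx : DifferentiableAt ℝ f x) :
    fderiv ℝ f x x = f x := by
  have hline : HasDerivAt (fun t : ℝ => t • x) x 1 := by
    simpa using (hasDerivAt_id (1 : ℝ)).smul_const x
  have hchain : HasDerivAt (fun t : ℝ => f (t • x)) (fderiv ℝ f x x) 1 := by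
    have hx1 : HasFDerivAt f (fderiv ℝ f x) ((1 : ℝ) • x) := by
      simpa using hx.hasFDerivAt
    exact hx1.comp_hasDerivAt (1 : ℝ) hline
  have hlin : HasDerivAt (fun t : ℝ => t * f x) (f x) 1 := by
    simpa using (hasDerivAt_id (1 : ℝ)).mul_const (f x)
  have heq : (fun t : ℝ => f (t • x)) =ᶠ[nhds 1] fun t => t * f x := by
    filter_upwards [lt_mem_nhds (zero_lt_one' ℝ)] with t ht using hhom t ht.le x
  exact hchain.unique (hlin.congr_of_eventuallyEq heq)

/-- A function with a supporting linear functional at every point is convex. -/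
theorem convexOn_univ_of_exists_linear_le [AddCommGroup E] [Module ℝ E] {g : E → ℝ}
    (h : ∀ z, ∃ L : E →ₗ[ℝ] ℝ, L z = g z ∧ ∀ y, L y ≤ g y) : ConvexOn ℝ Set.univ g := by
  refine ⟨convex_univ, fun x _ y _ a b ha hb _ => ?_⟩
  obtain ⟨L, hz, hL⟩ := h (a • x + b • y)
  rw [← hz, map_add, map_smul, map_smul]
  exact add_le_add (smul_le_smul_of_nonneg_left (hL x) ha)
    (smul_le_smul_of_nonneg_left (hL y) hb)

/-- Linearization error bound when the second derivative is bounded on a ball. -/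
theorem abs_sub_sub_fderiv_le_of_norm_fderiv_fderiv_le [NormedAddCommGroup E] [NormedSpace ℝ E]
    {f : E → ℝ} {x y : E} {M : ℝ}
    (hf : ∀ z ∈ Metric.closedBall x ‖y - x‖, DifferentiableAt ℝ f z)
    (hf' : ∀ z ∈ Metric.closedBall x ‖y - x‖, DifferentiableAt ℝ (fderiv ℝ f) z)
    (hM : ∀ z ∈ Metric.closedBall x ‖y - x‖, ‖fderiv ℝ (fderiv ℝ f) z‖ ≤ M) :
    |f y - f x - fderiv ℝ f x (y - x)| ≤ M * ‖y - x‖ ^ 2 := by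
  have hconv := convex_closedBall x ‖y - x‖
  have hx : x ∈ Metric.closedBall x ‖y - x‖ := Metric.mem_closedBall_self (norm_nonneg _)
  have hy : y ∈ Metric.closedBall x ‖y - x‖ := by simp [dist_eq_norm]
  have hM0 : 0 ≤ M := (norm_nonneg (fderiv ℝ (fderiv ℝ f) x)).trans (hM x hx)
  have hlip : ∀ z ∈ Metric.closedBall x ‖y - x‖,
      ‖fderiv ℝ f z - fderiv ℝ f x‖ ≤ M * ‖y - x‖ := fun z hz =>
    (hconv.norm_image_sub_le_of_norm_fderiv_le hf' hM hx hz).trans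
      (mul_le_mul_of_nonneg_left (by simpa [dist_eq_norm] using hz) hM0)
  have := hconv.norm_image_sub_le_of_norm_fderiv_le' hf hlip hx hy
  rw [Real.norm_eq_abs] at this
  linarith

variable [NormedAddCommGroup E] [InnerProductSpace ℝ E] [FiniteDimensional ℝ E]

/-- The tangent functionals of a positively 1-homogeneous `C²` function at unit vectors
fail to minorize it on the unit sphere by at most a quadratic error. -/
theorem exists_fderiv_apply_sub_le_mul_sq {f : E → ℝ}
    (hhom : ∀ t : ℝ, 0 ≤ t → ∀ x, f (t • x) = t * f x) (hC2 : ContDiffOn ℝ 2 f {(0 : E)}ᶜ) :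
    ∃ C : ℝ, 0 < C ∧ ∀ x y : E, ‖x‖ = 1 → ‖y‖ = 1 →
      fderiv ℝ f x y - f y ≤ C * ‖y - x‖ ^ 2 := by
  have hopen : IsOpen ({(0 : E)}ᶜ) := isOpen_compl_singleton
  have hdf : ∀ z : E, z ≠ 0 → DifferentiableAt ℝ f z := fun z hz =>
    (hC2.differentiableOn two_ne_zero).differentiableAt (hopen.mem_nhds hz)
  have hC1 : ContDiffOn ℝ 1 (fderiv ℝ f) {(0 : E)}ᶜ :=
    hC2.fderiv_of_isOpen hopen (by norm_num)
  have hddf : ∀ z : E, z ≠ 0 → DifferentiableAt ℝ (fderiv ℝ f) z := fun z hz =>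
    (hC1.differentiableOn one_ne_zero).differentiableAt (hopen.mem_nhds hz)
  have hcont : ContinuousOn (fderiv ℝ (fderiv ℝ f)) {(0 : E)}ᶜ :=
    hC1.continuousOn_fderiv_of_isOpen hopen le_rfl
  let K : Set E := Metric.closedBall 0 2 \ Metric.ball 0 (1 / 2)
  have hKc : IsCompact K := (isCompact_closedBall 0 2).diff Metric.isOpen_ball
  have hK0 : K ⊆ {(0 : E)}ᶜ := by
    rintro z hz rfl
    exact hz.2 (by simp)
  have hmem : ∀ z : E, 1 / 2 ≤ ‖z‖ → ‖z‖ ≤ 2 → z ∈ K := fun z h1 h2 =>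
    ⟨by simpa using h2, by simpa using h1⟩
  obtain ⟨B, hB⟩ := hKc.exists_bound_of_continuousOn (hC1.continuousOn.mono hK0)
  obtain ⟨M, hM⟩ := hKc.exists_bound_of_continuousOn (f := fderiv ℝ (fderiv ℝ f)) (hcont.mono hK0)
  refine ⟨8 * |B| + |M| + 1, by positivity, fun x y hx hy => ?_⟩
  have hxK : x ∈ K := hmem x (by rw [hx]; norm_num) (by rw [hx]; norm_num)
  have hyK : y ∈ K := hmem y (by rw [hy]; norm_num) (by rw [hy]; norm_num)
  have hsq := sq_nonneg ‖y - x‖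
  rcases le_or_gt ‖y - x‖ (1 / 2) with hnear | hfar
  · have hball : ∀ z ∈ Metric.closedBall x ‖y - x‖, z ∈ K := fun z hz => by
      have hzx : ‖z - x‖ ≤ 1 / 2 := by
        rw [Metric.mem_closedBall, dist_eq_norm] at hz
        exact hz.trans hnear
      have h1 := norm_sub_norm_le z x
      have h2 := norm_sub_norm_le x z
      rw [norm_sub_rev] at h2
      exact hmem z (by linarith) (by linarith)
    have htaylor := abs_sub_sub_fderiv_le_of_norm_fderiv_fderiv_le
      (fun z hz => hdf z (hK0 (hball z hz))) (fun z hz => hddf z (hK0 (hball z hz)))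
      fun z hz => hM z (hball z hz)
    rw [map_sub, fderiv_apply_self_of_posHomogeneous hhom (hdf x (hK0 hxK))] at htaylor
    have := (abs_le.1 htaylor).1
    nlinarith [le_abs_self M, abs_nonneg B]
  · have hbound : ∀ z ∈ K, |fderiv ℝ f z y| ≤ |B| := fun z hz => by
      have h := (fderiv ℝ f z).le_of_opNorm_le ((hB z hz).trans (le_abs_self B)) y
      rwa [hy, mul_one, Real.norm_eq_abs] at h
    have h1 := (abs_le.1 (hbound x hxK)).2
    have h2 := (abs_le.1 (hbound y hyK)).1
    rw [fderiv_apply_self_of_posHomogeneous hhom (hdf y (hK0 hyK))] at h2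
    have h3 : 1 / 4 ≤ ‖y - x‖ ^ 2 := by nlinarith
    nlinarith [abs_nonneg M, abs_nonneg B]

/-- A positively 1-homogeneous function of class `C²` away from the origin has, after adding a
suitable multiple of the norm, a supporting linear functional at each point. -/
theorem exists_linear_le_add_const_mul_norm {f : E → ℝ}
    (hhom : ∀ t : ℝ, 0 ≤ t → ∀ x, f (t • x) = t * f x) (hC2 : ContDiffOn ℝ 2 f {(0 : E)}ᶜ) :
    ∃ c : ℝ, 0 < c ∧ ∀ z, ∃ L : E →ₗ[ℝ] ℝ, L z = f z + c * ‖z‖ ∧ ∀ y, L y ≤ f y + c * ‖y‖ := by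
  have hf0 : f 0 = 0 := by simpa using hhom 0 le_rfl 0
  obtain ⟨C, hC, hquad⟩ := exists_fderiv_apply_sub_le_mul_sq hhom hC2
  have hunit : ∀ u : E, ‖u‖ = 1 → ∃ L : E →ₗ[ℝ] ℝ,
      L u = f u + 2 * C * ‖u‖ ∧ ∀ y, L y ≤ f y + 2 * C * ‖y‖ := fun u hu => by
    have hu0 : u ≠ 0 := norm_ne_zero_iff.1 (by rw [hu]; exact one_ne_zero)
    have hdu : DifferentiableAt ℝ f u := (hC2.differentiableOn two_ne_zero).differentiableAt
      (isOpen_compl_singleton.mem_nhds hu0)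
    refine ⟨(fderiv ℝ f u + (2 * C) • innerSL ℝ u).toLinearMap, ?_, fun y => ?_⟩
    · simp [fderiv_apply_self_of_posHomogeneous hhom hdu, hu]
    · rcases eq_or_ne y 0 with rfl | hy
      · simp [hf0]
      have hy' : 0 < ‖y‖ := norm_pos_iff.2 hy
      obtain ⟨v, hv, hyv⟩ : ∃ v : E, ‖v‖ = 1 ∧ y = ‖y‖ • v :=
        ⟨‖y‖⁻¹ • y, by simp [norm_smul, hy'.ne'], by simp [smul_smul, hy'.ne']⟩
      have hv2 := hquad u v hu hv
      rw [norm_sub_sq_real, hu, hv, real_inner_comm] at hv2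
      have hfy : f y = ‖y‖ * f v := by
        conv_lhs => rw [hyv]
        exact hhom _ hy'.le v
      have hLy : (fderiv ℝ f u + (2 * C) • innerSL ℝ u) y
          = ‖y‖ * (fderiv ℝ f u v + 2 * C * inner ℝ u v) := by
        conv_lhs => rw [hyv]
        simp
      have := mul_le_mul_of_nonneg_left hv2 hy'.le
      rw [ContinuousLinearMap.coe_coe, hLy, hfy]
      linarith
  refine ⟨2 * C, by positivity, fun z => ?_⟩
  rcases subsingleton_or_nontrivial E with hE | hE
  · refine ⟨0, ?_, fun y => ?_⟩
    · simp [Subsingleton.elim z 0, hf0]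
    · simp [Subsingleton.elim y 0, hf0]
  rcases eq_or_ne z 0 with rfl | hz
  · obtain ⟨u, hu⟩ := exists_norm_eq E (zero_le_one' ℝ)
    obtain ⟨L, -, hL⟩ := hunit u hu
    exact ⟨L, by simp [hf0], hL⟩
  · have hz' : 0 < ‖z‖ := norm_pos_iff.2 hz
    obtain ⟨L, hLu, hL⟩ := hunit (‖z‖⁻¹ • z) (by simp [norm_smul, hz'.ne'])
    refine ⟨L, ?_, hL⟩
    rw [map_smul, hhom _ (inv_nonneg.2 hz'.le), norm_smul, norm_inv, norm_norm, smul_eq_mul] at hLu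
    field_simp at hLu
    linarith

end PositivelyHomogeneous

/-- A positively 1-homogeneous function of class `C²` away from the origin becomes convex
(hence a support function) after adding a suitable multiple of the norm. -/
theorem exists_add_const_mul_norm_convexOn {d : ℕ} (f : Ed d → ℝ)
    (hf0 : f 0 = 0) (hhom : PosHomogeneous f)
    (hC2 : ContDiffOn ℝ 2 f ({(0 : Ed d)}ᶜ)) :
    ∃ c : ℝ, 0 < c ∧ ConvexOn ℝ Set.univ (fun x => f x + c * ‖x‖) := by
  obtain ⟨c, hc, hL⟩ := exists_linear_le_add_const_mul_norm hhom hC2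
  exact ⟨c, hc, convexOn_univ_of_exists_linear_le hL⟩
end
end

section
/- Let μ be a finite nonnegative Borel measure on ℝ^d with finite first moment that is not of the form c·δ_0 for any c > 0, and let μ_S be its homogeneous marginal. Then both Q_m(μ, μ_S) and Q_m(μ_S, μ) are nonempty, i.e. there exist moment-preserving unnormalized kernels transporting μ to μ_S and transporting μ_S to μ. -/
open MeasureTheory Filter
open scoped ENNReal NNReal

noncomputable section

/-- The homogeneous marginal `μ_S` of `μ`: the image on the unit sphere of the measure
with density `‖x‖` under the radial projection `x ↦ x/‖x‖`. It satisfies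
`∫ f(u) μ_S(du) = ∫ ‖x‖ f(x/‖x‖) μ(dx)` for bounded Borel `f`. -/
def homMarginal {d : ℕ} (μ : Measure (Ed d)) : Measure (Ed d) :=
  Measure.map (fun x => ‖x‖⁻¹ • x) (μ.withDensity fun x => ENNReal.ofReal ‖x‖)

lemma measurable_inv_norm_smul {d : ℕ} : Measurable fun x : Ed d => ‖x‖⁻¹ • x := by
  fun_prop

/-- The density `‖x‖⁻¹`, equal to `0` at the origin. -/
def invNorm {d : ℕ} (x : Ed d) : ℝ≥0 := ‖x‖₊⁻¹

lemma measurable_invNorm {d : ℕ} : Measurable (invNorm : Ed d → ℝ≥0) := by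
  unfold invNorm
  fun_prop

lemma invNorm_smul {d : ℕ} (x : Ed d) : invNorm x • x = ‖x‖⁻¹ • x := by
  simp [invNorm, NNReal.smul_def]

lemma ofReal_norm_mul_invNorm {d : ℕ} (x : Ed d) :
    ENNReal.ofReal ‖x‖ * (invNorm x : ℝ≥0∞) = Set.indicator {0}ᶜ 1 x := by
  by_cases hx : x = 0
  · simp [hx]
  · have h : ‖x‖₊ ≠ 0 := by simpa using hx
    rw [ofReal_norm, enorm_eq_nnnorm, invNorm, ← ENNReal.coe_mul, mul_inv_cancel₀ h]
    simp [hx]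

lemma homMarginal_apply {d : ℕ} (μ : Measure (Ed d)) {A : Set (Ed d)} (hA : MeasurableSet A) :
    homMarginal μ A = ∫⁻ x, ENNReal.ofReal ‖x‖ * A.indicator 1 (‖x‖⁻¹ • x) ∂μ := by
  have hT := measurable_inv_norm_smul (d := d)
  rw [homMarginal, Measure.map_apply hT hA, withDensity_apply _ (hT hA),
    ← lintegral_indicator (hT hA)]
  refine lintegral_congr fun x => ?_
  by_cases hx : ‖x‖⁻¹ • x ∈ A <;> simp [Set.indicator, hx]

/-- Placing mass `‖x‖` at `‖x‖⁻¹ • x` transports `μ` to its homogeneous marginal. -/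
lemma exists_momentPreserving_kernel_to_homMarginal {d : ℕ} (μ : Measure (Ed d)) :
    ∃ p : Ed d → Measure (Ed d),
      IsUKernel p ∧ Transports p μ (homMarginal μ) ∧ MomentPreserving p μ := by
  have hT := measurable_inv_norm_smul (d := d)
  refine ⟨fun x => ENNReal.ofReal ‖x‖ • Measure.dirac (‖x‖⁻¹ • x), ⟨fun x => ?_, ?_⟩, ?_, ?_⟩
  · exact Measure.smul_finite _ ENNReal.ofReal_ne_top
  · intro A hA
    simp only [Measure.smul_apply, Measure.dirac_apply' _ hA, smul_eq_mul]
    exact Measurable.mul (by fun_prop) ((measurable_one.indicator hA).comp hT)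
  · intro A hA
    simp only [Measure.smul_apply, Measure.dirac_apply' _ hA, smul_eq_mul]
    exact (homMarginal_apply μ hA).symm
  · refine ae_of_all _ fun x => ?_
    by_cases hx : x = 0
    · simp [hx]
    · simp [integral_smul_measure, hx]

/-- A measure carried by the ray of `u` has barycenter `u` after reweighting by `‖x‖⁻¹`
and adding any mass at the origin. -/
lemma integral_id_withDensity_invNorm_add_dirac {d : ℕ} {κ : Measure (Ed d)}
    [IsProbabilityMeasure κ] {u : Ed d} (hu : ∀ᵐ x ∂κ, ‖x‖⁻¹ • x = u) {c : ℝ≥0∞}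
    (hc : c ≠ ∞) :
    ∫ y, y ∂(κ.withDensity (fun x => (invNorm x : ℝ≥0∞)) + c • Measure.dirac 0) = u := by
  have hae : (fun x => invNorm x • x) =ᵐ[κ] fun _ => u := by
    filter_upwards [hu] with x hx
    rw [invNorm_smul, hx]
  rw [integral_add_measure, integral_withDensity_eq_integral_smul measurable_invNorm,
    integral_congr_ae hae, integral_smul_measure]
  · simp
  · rw [integrable_withDensity_iff_integrable_smul measurable_invNorm]
    exact (integrable_const u).congr hae.symm
  · exact (integrable_dirac (by simp)).smul_measure hc

/-- Disintegration of `‖x‖ μ(dx)` along the radial projection. -/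
lemma exists_disintegration_homMarginal {d : ℕ} (μ : Measure (Ed d)) [IsFiniteMeasure μ]
    (hμ : Integrable (fun x => ‖x‖) μ) :
    ∃ κ : ProbabilityTheory.Kernel (Ed d) (Ed d), ProbabilityTheory.IsMarkovKernel κ ∧
      (∀ᵐ u ∂(homMarginal μ), ∀ᵐ x ∂(κ u), ‖x‖⁻¹ • x = u) ∧
      ∀ g : Ed d → ℝ≥0∞, Measurable g →
        ∫⁻ u, ∫⁻ x, g x ∂(κ u) ∂(homMarginal μ) = ∫⁻ x, ENNReal.ofReal ‖x‖ * g x ∂μ := by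
  have hT := measurable_inv_norm_smul (d := d)
  have hpair : Measurable fun x : Ed d => (‖x‖⁻¹ • x, x) := hT.prodMk measurable_id
  have hfin : IsFiniteMeasure (μ.withDensity fun x => ENNReal.ofReal ‖x‖) :=
    isFiniteMeasure_withDensity_ofReal hμ.2
  set ρ : Measure (Ed d × Ed d) :=
    Measure.map (fun x => (‖x‖⁻¹ • x, x)) (μ.withDensity fun x => ENNReal.ofReal ‖x‖) with hρ
  have hfst : ρ.fst = homMarginal μ := Measure.fst_map_prodMk measurable_id
  have hdis : (homMarginal μ).compProd ρ.condKernel = ρ := by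
    rw [← hfst]
    exact ρ.disintegrate ρ.condKernel
  have : IsFiniteMeasure (homMarginal μ) := by
    rw [← hfst]
    infer_instance
  refine ⟨ρ.condKernel, inferInstance, ?_, fun g hg => ?_⟩
  · apply Measure.ae_ae_of_ae_compProd (p := fun z : Ed d × Ed d => ‖z.2‖⁻¹ • z.2 = z.1)
    rw [hdis, hρ, ae_map_iff hpair.aemeasurable
      (measurableSet_eq_fun (by fun_prop) measurable_fst)]
    exact ae_of_all _ fun _ => rfl
  · rw [← Measure.lintegral_compProd (f := fun z => g z.2) (hg.comp measurable_snd), hdis, hρ,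
      lintegral_map (f := fun z : Ed d × Ed d => g z.2) (hg.comp measurable_snd) hpair]
    exact lintegral_withDensity_eq_lintegral_mul μ (by fun_prop) hg

/-- If `μ` has no mass at the origin whenever `μ_S` vanishes, reweighted conditional laws
transport `μ_S` to `μ`. -/
lemma exists_momentPreserving_kernel_of_homMarginal {d : ℕ} (μ : Measure (Ed d))
    [IsFiniteMeasure μ] (hμ : Integrable (fun x => ‖x‖) μ)
    (h0 : homMarginal μ Set.univ = 0 → μ {0} = 0) :
    ∃ q : Ed d → Measure (Ed d),
      IsUKernel q ∧ Transports q (homMarginal μ) μ ∧ MomentPreserving q (homMarginal μ) := by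
  obtain ⟨κ, hκ, hray, hint⟩ := exists_disintegration_homMarginal μ hμ
  have hf : Measurable fun x : Ed d => (invNorm x : ℝ≥0∞) :=
    measurable_invNorm.coe_nnreal_ennreal
  have hTop : homMarginal μ Set.univ ≠ ∞ := by
    rw [homMarginal_apply μ .univ]
    simpa using (hasFiniteIntegral_iff_ofReal (ae_of_all _ fun x => norm_nonneg x)).1 hμ.2 |>.ne
  set c : ℝ≥0∞ := μ {0} / homMarginal μ Set.univ
  have hc : c ≠ ∞ := by
    by_cases h : homMarginal μ Set.univ = 0
    · simp [c, h0 h]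
    · exact ENNReal.div_ne_top (measure_ne_top _ _) h
  have hcmul : c * homMarginal μ Set.univ = μ {0} := by
    by_cases h : homMarginal μ Set.univ = 0
    · simp [h, h0 h]
    · exact ENNReal.div_mul_cancel h hTop
  set η : Ed d → Measure (Ed d) := fun u => (κ u).withDensity fun x => (invNorm x : ℝ≥0∞)
    with hη
  have hη_meas : ∀ A, MeasurableSet A → Measurable fun u => η u A := by
    intro A hA
    simp only [hη, withDensity_apply _ hA, ← lintegral_indicator hA]
    exact (hf.indicator hA).lintegral_kernel
  have hη_int : ∀ A, MeasurableSet A → ∫⁻ u, η u A ∂(homMarginal μ) = μ (A \ {0}) := by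
    intro A hA
    simp only [hη, withDensity_apply _ hA, ← lintegral_indicator hA]
    rw [hint _ (hf.indicator hA), ← lintegral_indicator_one (hA.diff (measurableSet_singleton 0))]
    refine lintegral_congr fun x => ?_
    by_cases hx : x ∈ A
    · simp only [Set.indicator_of_mem hx, ofReal_norm_mul_invNorm]
      by_cases hx0 : x = 0 <;> simp [Set.indicator, hx, hx0]
    · simp [hx]
  set G : Set (Ed d) := {u | η u Set.univ < ∞}
  have hG_meas : MeasurableSet G := hη_meas _ .univ measurableSet_Iio
  have hG_ae : ∀ᵐ u ∂(homMarginal μ), u ∈ G :=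
    ae_lt_top (hη_meas _ .univ) (by rw [hη_int _ .univ]; exact measure_ne_top _ _)
  classical
  refine ⟨fun u => if u ∈ G then η u + c • Measure.dirac 0 else 0, ⟨fun u => ?_, ?_⟩, ?_, ?_⟩
  · by_cases hu : u ∈ G
    · have : IsFiniteMeasure (η u) := ⟨hu⟩
      have : IsFiniteMeasure (c • Measure.dirac (0 : Ed d)) := Measure.smul_finite _ hc
      simp only [hu, if_true]
      infer_instance
    · simp only [hu, if_false]
      infer_instance
  · intro A hA
    have heq : (fun u => (if u ∈ G then η u + c • Measure.dirac 0 else 0 : Measure (Ed d)) A)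
        = fun u => if u ∈ G then η u A + c * Measure.dirac 0 A else 0 := by
      funext u
      split_ifs <;> simp
    rw [heq]
    exact ((hη_meas A hA).add_const _).ite hG_meas measurable_const
  · intro A hA
    have hae : (fun u => (if u ∈ G then η u + c • Measure.dirac 0 else 0 : Measure (Ed d)) A)
        =ᵐ[homMarginal μ] fun u => η u A + c * Measure.dirac 0 A := by
      filter_upwards [hG_ae] with u hu
      simp [hu]
    rw [lintegral_congr_ae hae, lintegral_add_left (hη_meas A hA), hη_int A hA,
      lintegral_const, mul_right_comm, hcmul, Measure.dirac_apply' _ hA]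
    by_cases h : (0 : Ed d) ∈ A
    · have hinter : A ∩ {0} = {0} :=
        Set.inter_eq_right.2 (Set.singleton_subset_iff.2 h)
      rw [← measure_sdiff_add_inter (μ := μ) A (measurableSet_singleton 0), hinter]
      simp [h]
    · simp [h]
  · filter_upwards [hG_ae, hray] with u hu hray_u
    simp only [hu, if_true]
    exact integral_id_withDensity_invNorm_add_dirac hray_u hc

lemma eq_smul_dirac_of_homMarginal_univ_eq_zero {d : ℕ} (μ : Measure (Ed d))
    (h : homMarginal μ Set.univ = 0) : μ = μ {0} • Measure.dirac 0 := by
  simp only [homMarginal_apply μ .univ, Set.indicator_univ, Pi.one_apply, mul_one] at h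
  rw [lintegral_eq_zero_iff (by fun_prop)] at h
  have hae : ∀ᵐ x ∂μ, x = 0 := by
    filter_upwards [h] with x hx
    simpa using hx
  rw [← Measure.restrict_singleton]
  exact (Measure.restrict_eq_self_of_ae_mem hae).symm

/-- If `μ` is not a positive multiple of `δ₀`, then there are moment-preserving
unnormalized kernels transporting `μ` to its homogeneous marginal `μ_S` and back. -/
theorem exists_momentPreserving_kernels_homMarginal {d : ℕ}
    (μ : Measure (Ed d)) [IsFiniteMeasure μ]
    (hμ : Integrable (fun x => ‖x‖) μ)
    (hnd : ∀ c : ℝ, 0 < c → μ ≠ ENNReal.ofReal c • Measure.dirac (0 : Ed d)) :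
    (∃ p : Ed d → Measure (Ed d),
        IsUKernel p ∧ Transports p μ (homMarginal μ) ∧ MomentPreserving p μ) ∧
    (∃ q : Ed d → Measure (Ed d),
        IsUKernel q ∧ Transports q (homMarginal μ) μ ∧
          MomentPreserving q (homMarginal μ)) := by
  refine ⟨exists_momentPreserving_kernel_to_homMarginal μ,
    exists_momentPreserving_kernel_of_homMarginal μ hμ fun h => ?_⟩
  by_contra h0
  refine hnd (μ {0}).toReal (ENNReal.toReal_pos h0 (measure_ne_top _ _)) ?_
  rw [ENNReal.ofReal_toReal (measure_ne_top _ _)]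
  exact eq_smul_dirac_of_homMarginal_univ_eq_zero μ h
end
end

section
/- Let μ, ν, ρ be finite nonnegative Borel measures on ℝ^d with finite first moments, let p be an unnormalized kernel transporting μ to ν and q an unnormalized kernel transporting ν to ρ. Define the kernel r by r^x = ∫ q^y p^x(dy). Then r transports μ to ρ and satisfies ∫ |x − ba(r^x)| μ(dx) ≤ ∫ |x − ba(p^x)| μ(dx) + ∫ |y − ba(q^y)| ν(dy), where ba(σ) := ∫ z σ(dz). In particular, if p and q are both moment-preserving, then so is r. -/
open MeasureTheory Filter
open scoped ENNReal NNReal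

noncomputable section

open ProbabilityTheory

section

variable {d : ℕ}

/-- The bundled kernel associated with an unnormalized kernel. -/
def IsUKernel.toKernel {q : Ed d → Measure (Ed d)} (hq : IsUKernel q) : Kernel (Ed d) (Ed d) :=
  ⟨q, Measure.measurable_of_measurable_coe _ hq.2⟩

lemma Transports.bind_eq {q : Ed d → Measure (Ed d)} {μ ν : Measure (Ed d)}
    (hq : IsUKernel q) (h : Transports q μ ν) : μ.bind hq.toKernel = ν := by
  ext A hA
  rw [Measure.bind_apply hA (Kernel.aemeasurable _)]
  exact h A hA

/-- Gluing of kernels preserves transport. -/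
lemma Transports.glue {p q : Ed d → Measure (Ed d)} {μ ν ρ : Measure (Ed d)}
    (hp : IsUKernel p) (hq : IsUKernel q) (hpt : Transports p μ ν) (hqt : Transports q ν ρ) :
    Transports (fun x => (p x).bind q) μ ρ := by
  intro A hA
  rw [← hqt.bind_eq hq, ← hpt.bind_eq hp, Measure.comp_assoc,
    Measure.bind_apply hA (Kernel.aemeasurable _)]
  rfl

end

/-- A Bochner-integrable function with respect to the composition of a measure with two kernels
satisfies Fubini's formula for the composed kernel almost everywhere. -/
lemma ae_integral_kernel_comp {α β γ E : Type*} [MeasurableSpace α] [MeasurableSpace β]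
    [MeasurableSpace γ] [NormedAddCommGroup E] [NormedSpace ℝ E]
    {μ : Measure α} {κ : Kernel α β} {η : Kernel β γ} {f : γ → E}
    (hf : Integrable f (μ.bind (η ∘ₖ κ))) :
    ∀ᵐ x ∂μ, ∫ z, f z ∂(η ∘ₖ κ) x = ∫ y, ∫ z, f z ∂η y ∂κ x :=
  (Measure.ae_integrable_of_integrable_comp hf).mono fun _ hx => Kernel.integral_comp hx

lemma integrable_integral_of_integrable_bind {α β E : Type*} [MeasurableSpace α]
    [MeasurableSpace β] [NormedAddCommGroup E] [NormedSpace ℝ E]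
    {μ : Measure α} {κ : Kernel α β} {f : β → E} (hf : Integrable f (μ.bind κ)) :
    Integrable (fun x => ∫ y, f y ∂κ x) μ := by
  rw [Measure.comp_eq_comp_const_apply] at hf
  exact hf.integral_comp

/-- **Gluing lemma.** If `p` transports `μ` to `ν` and `q` transports `ν` to `ρ`, then the
glued kernel `r^x = ∫ q^y p^x(dy)` transports `μ` to `ρ` and satisfies
`∫ |x − ba(r^x)| dμ ≤ ∫ |x − ba(p^x)| dμ + ∫ |y − ba(q^y)| dν`;
in particular, if `p` and `q` are moment-preserving then so is `r`. -/
theorem gluing {d : ℕ} (μ ν ρ : Measure (Ed d))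
    [IsFiniteMeasure μ] [IsFiniteMeasure ν] [IsFiniteMeasure ρ]
    (hμ : Integrable (fun x => ‖x‖) μ) (hν : Integrable (fun x => ‖x‖) ν)
    (hρ : Integrable (fun x => ‖x‖) ρ)
    (p q : Ed d → Measure (Ed d)) (hp : IsUKernel p) (hq : IsUKernel q)
    (hpt : Transports p μ ν) (hqt : Transports q ν ρ)
    (r : Ed d → Measure (Ed d)) (hr : ∀ x, r x = (p x).bind q) :
    Transports r μ ρ ∧
    (∫ x, ‖x - ∫ z, z ∂(r x)‖ ∂μ ≤
      ∫ x, ‖x - ∫ z, z ∂(p x)‖ ∂μ + ∫ y, ‖y - ∫ z, z ∂(q y)‖ ∂ν) ∧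
    (MomentPreserving p μ → MomentPreserving q ν → MomentPreserving r μ) := by
  obtain rfl : r = fun x => (p x).bind q := funext hr
  have hrt := hpt.glue hp hq hqt
  have hνb := hpt.bind_eq hp
  have hρb := hqt.bind_eq hq
  have hμi : Integrable (fun x : Ed d => x) μ :=
    (integrable_norm_iff measurable_id.aestronglyMeasurable).1 hμ
  have hνi : Integrable (fun x : Ed d => x) ν :=
    (integrable_norm_iff measurable_id.aestronglyMeasurable).1 hν
  have hρi : Integrable (fun x : Ed d => x) ρ :=
    (integrable_norm_iff measurable_id.aestronglyMeasurable).1 hρ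
  have hbq : Integrable (fun y => ∫ z, z ∂q y) ν :=
    integrable_integral_of_integrable_bind (κ := hq.toKernel) (hρb ▸ hρi)
  have hbp : Integrable (fun x => ∫ z, z ∂p x) μ :=
    integrable_integral_of_integrable_bind (κ := hp.toKernel) (hνb ▸ hνi)
  have hdef : Integrable (fun y => ‖y - ∫ z, z ∂q y‖) (μ.bind hp.toKernel) :=
    hνb.symm ▸ (hνi.sub hbq).norm
  have hdefμ : Integrable (fun x => ∫ y, ‖y - ∫ z, z ∂q y‖ ∂p x) μ :=
    integrable_integral_of_integrable_bind (κ := hp.toKernel) hdef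
  have hpi : ∀ᵐ x ∂μ, Integrable (fun y => y) (p x) :=
    Measure.ae_integrable_of_integrable_comp (κ := hp.toKernel) (hνb ▸ hνi)
  have hpbq : ∀ᵐ x ∂μ, Integrable (fun y => ∫ z, z ∂q y) (p x) :=
    Measure.ae_integrable_of_integrable_comp (κ := hp.toKernel) (hνb ▸ hbq)
  have hba : ∀ᵐ x ∂μ, ∫ z, z ∂((p x).bind q) = ∫ y, ∫ z, z ∂q y ∂p x := by
    refine ae_integral_kernel_comp (κ := hp.toKernel) (η := hq.toKernel) ?_
    rwa [← Measure.comp_assoc, hνb, hρb]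
  refine ⟨hrt, ?_, fun hpm hqm => ?_⟩
  · have htower : ∫ x, ∫ y, ‖y - ∫ z, z ∂q y‖ ∂p x ∂μ = ∫ y, ‖y - ∫ z, z ∂q y‖ ∂ν := by
      rw [← hνb]
      rw [Measure.comp_eq_comp_const_apply] at hdef ⊢
      exact (Kernel.integral_comp hdef).symm
    have hdisp : Integrable (fun x => ‖x - ∫ z, z ∂p x‖) μ := (hμi.sub hbp).norm
    rw [← htower, ← integral_add hdisp hdefμ]
    refine integral_mono_of_nonneg (ae_of_all _ fun _ => norm_nonneg _)
      (hdisp.add hdefμ) ?_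
    filter_upwards [hpi, hpbq, hba] with x hx hxq hxb
    calc ‖x - ∫ z, z ∂((p x).bind q)‖
        = ‖(x - ∫ z, z ∂p x) + ∫ y, (y - ∫ z, z ∂q y) ∂p x‖ := by
          rw [hxb, integral_sub hx hxq, sub_add_sub_cancel]
      _ ≤ ‖x - ∫ z, z ∂p x‖ + ∫ y, ‖y - ∫ z, z ∂q y‖ ∂p x :=
          (norm_add_le _ _).trans (by gcongr; exact norm_integral_le_integral_norm _)
  · have hqm' : ∀ᵐ x ∂μ, ∀ᵐ y ∂p x, ∫ z, z ∂q y = y :=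
      Measure.ae_ae_of_ae_comp (κ := hp.toKernel) (hνb ▸ hqm)
    filter_upwards [hba, hpm, hqm'] with x hxb hxp hxq
    rw [hxb, integral_congr_ae hxq, hxp]
end
end

section
/- Let μ and ν be finite nonnegative Borel measures on ℝ^d with finite first moments satisfying μ ≼phc ν and ∫ |x| μ(dx) = ∫ |x| ν(dx). Then μ ≡ph ν, i.e. ∫ f dμ = ∫ f dν for every positively 1-homogeneous Borel function f : ℝ^d → ℝ bounded on the unit sphere. -/
open MeasureTheory Filter
open scoped ENNReal NNReal

noncomputable section

open scoped RealInnerProductSpace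

variable {E : Type*} [NormedAddCommGroup E] [InnerProductSpace ℝ E]

/-- The second-order Taylor remainder of the cosine is quadratic, uniformly in the base point. -/
lemma cos_taylor_lower_bound (c u : ℝ) :
    Real.cos c - Real.sin c * (u - c) - 4 * (u - c) ^ 2 ≤ Real.cos u := by
  obtain ⟨h, rfl⟩ : ∃ h, u = c + h := ⟨u - c, by ring⟩
  rw [add_sub_cancel_left, Real.cos_add]
  have hcos : 1 - h ^ 2 / 2 ≤ Real.cos h := Real.one_sub_sq_div_two_le_cos
  have hsin : |Real.sin h - h| ≤ 3 * h ^ 2 := by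
    rcases le_total |h| 1 with h1 | h1
    · have hb := Complex.norm_exp_sub_one_sub_id_le (x := h * Complex.I) (by simpa using h1)
      have him := (Complex.abs_im_le_norm _).trans hb
      simp [Complex.exp_ofReal_mul_I_im] at him
      nlinarith [sq_nonneg h]
    · have := abs_sub (Real.sin h) h
      have := Real.abs_sin_le_one h
      nlinarith [sq_abs h]
  have hs : Real.sin c * (Real.sin h - h) ≤ 3 * h ^ 2 :=
    (le_abs_self _).trans (by
      rw [abs_mul]
      nlinarith [Real.abs_sin_le_one c, abs_nonneg (Real.sin h - h)])
  have hc : Real.cos c * (1 - Real.cos h) ≤ h ^ 2 / 2 := by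
    nlinarith [Real.cos_le_one c, Real.cos_le_one h]
  nlinarith [sq_nonneg h]

/-- The positively 1-homogeneous extension of `x ↦ cos (⟪x, θ⟫ + α)` from the unit sphere. -/
def homCos (θ : E) (α : ℝ) (x : E) : ℝ := ‖x‖ * Real.cos (⟪‖x‖⁻¹ • x, θ⟫ + α)

lemma abs_homCos_le (θ : E) (α : ℝ) (x : E) : |homCos θ α x| ≤ ‖x‖ := by
  rw [homCos, abs_mul, abs_norm]
  exact mul_le_of_le_one_right (norm_nonneg x) (Real.abs_cos_le_one _)

lemma homCos_smul (θ : E) (α : ℝ) {t : ℝ} (ht : 0 ≤ t) (x : E) :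
    homCos θ α (t • x) = t * homCos θ α x := by
  rcases ht.eq_or_lt with rfl | ht
  · simp [homCos]
  · have : (t * ‖x‖)⁻¹ • t • x = ‖x‖⁻¹ • x := by
      rw [smul_smul]
      congr 1
      field_simp
    rw [homCos, homCos, norm_smul, Real.norm_of_nonneg ht.le, this, mul_assoc]

/-- Supporting affine bound for `homCos` at a unit vector `e`, up to a multiple of
`‖x‖ - ⟪x, e⟫`. -/
lemma homCos_lower_bound (θ : E) (α : ℝ) {e : E} (he : ‖e‖ = 1) (x : E) :
    ‖x‖ * Real.cos (⟪e, θ⟫ + α) - Real.sin (⟪e, θ⟫ + α) * (⟪x, θ⟫ - ‖x‖ * ⟪e, θ⟫)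
      - 8 * ‖θ‖ ^ 2 * (‖x‖ - ⟪x, e⟫) ≤ homCos θ α x := by
  rcases eq_or_ne x 0 with rfl | hx
  · simp [homCos]
  have hx' : 0 < ‖x‖ := norm_pos_iff.2 hx
  have key := cos_taylor_lower_bound (⟪e, θ⟫ + α) (⟪‖x‖⁻¹ • x, θ⟫ + α)
  have hdiff : ⟪‖x‖⁻¹ • x, θ⟫ + α - (⟪e, θ⟫ + α) = ⟪‖x‖⁻¹ • x - e, θ⟫ := by
    rw [inner_sub_left]; ring
  rw [hdiff] at key
  have hsq : ⟪‖x‖⁻¹ • x - e, θ⟫ ^ 2 ≤ ‖‖x‖⁻¹ • x - e‖ ^ 2 * ‖θ‖ ^ 2 := by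
    rw [← mul_pow]
    exact sq_le_sq' (neg_le_of_abs_le (abs_real_inner_le_norm _ _)) (real_inner_le_norm _ _)
  have hnorm : ‖x‖ * ‖‖x‖⁻¹ • x - e‖ ^ 2 = 2 * (‖x‖ - ⟪x, e⟫) := by
    rw [norm_sub_sq_real, he, norm_smul, norm_inv, norm_norm, real_inner_smul_left]
    field_simp
    ring
  have hlin : ‖x‖ * ⟪‖x‖⁻¹ • x - e, θ⟫ = ⟪x, θ⟫ - ‖x‖ * ⟪e, θ⟫ := by
    rw [inner_sub_left, real_inner_smul_left]
    field_simp
  have h1 := mul_le_mul_of_nonneg_left key hx'.le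
  have h2 := mul_le_mul_of_nonneg_left hsq hx'.le
  rw [← mul_assoc, hnorm] at h2
  rw [homCos, ← hlin]
  linarith

/-- Adding a large multiple of the norm makes `homCos` subadditive. -/
lemma homCos_add_norm_subadditive (θ : E) (α : ℝ) (x y : E) :
    homCos θ α (x + y) + (1 + ‖θ‖ + 8 * ‖θ‖ ^ 2) * ‖x + y‖ ≤
      (homCos θ α x + (1 + ‖θ‖ + 8 * ‖θ‖ ^ 2) * ‖x‖) +
        (homCos θ α y + (1 + ‖θ‖ + 8 * ‖θ‖ ^ 2) * ‖y‖) := by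
  rcases eq_or_ne (x + y) 0 with hz | hz
  · have hx := neg_le_of_abs_le (abs_homCos_le θ α x)
    have hy := neg_le_of_abs_le (abs_homCos_le θ α y)
    have : 0 ≤ (‖θ‖ + 8 * ‖θ‖ ^ 2) * (‖x‖ + ‖y‖) := by positivity
    rw [hz]
    simp only [homCos, norm_zero, zero_mul, mul_zero, add_zero] at *
    linarith
  have hz' : 0 < ‖x + y‖ := norm_pos_iff.2 hz
  set e := ‖x + y‖⁻¹ • (x + y) with he_def
  have he : ‖e‖ = 1 := norm_smul_inv_norm (𝕜 := ℝ) hz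
  have hx := homCos_lower_bound θ α he x
  have hy := homCos_lower_bound θ α he y
  have hsumθ : ⟪x, θ⟫ + ⟪y, θ⟫ = ‖x + y‖ * ⟪e, θ⟫ := by
    rw [he_def, real_inner_smul_left, ← inner_add_left]
    field_simp
  have hsume : ⟪x, e⟫ + ⟪y, e⟫ = ‖x + y‖ := by
    rw [he_def, ← inner_add_left, real_inner_smul_right, real_inner_self_eq_norm_sq]
    field_simp
  have hδ : 0 ≤ ‖x‖ + ‖y‖ - ‖x + y‖ := sub_nonneg.2 (norm_add_le x y)
  have hc := Real.neg_one_le_cos (⟪e, θ⟫ + α)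
  have hs : |Real.sin (⟪e, θ⟫ + α) * ⟪e, θ⟫| ≤ ‖θ‖ := by
    have h1 := abs_real_inner_le_norm e θ
    rw [he, one_mul] at h1
    rw [abs_mul]
    nlinarith [Real.abs_sin_le_one (⟪e, θ⟫ + α), abs_nonneg ⟪e, θ⟫]
  have hcoef : 0 ≤ Real.cos (⟪e, θ⟫ + α) + Real.sin (⟪e, θ⟫ + α) * ⟪e, θ⟫ + 1 + ‖θ‖ := by
    linarith [neg_le_of_abs_le hs]
  have hprod := mul_nonneg hδ hcoef
  have hzval : homCos θ α (x + y) = ‖x + y‖ * Real.cos (⟪e, θ⟫ + α) := rfl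
  have hy' : ⟪y, θ⟫ = ‖x + y‖ * ⟪e, θ⟫ - ⟪x, θ⟫ := by linarith
  have hye : ⟪y, e⟫ = ‖x + y‖ - ⟪x, e⟫ := by linarith
  rw [hy', hye] at hy
  rw [hzval]
  linarith

lemma isSupportFunction_homCos_add_norm {d : ℕ} (θ : Ed d) (α : ℝ) :
    IsSupportFunction fun x => homCos θ α x + (1 + ‖θ‖ + 8 * ‖θ‖ ^ 2) * ‖x‖ := by
  have hhom : ∀ t : ℝ, 0 ≤ t → ∀ x : Ed d,
      homCos θ α (t • x) + (1 + ‖θ‖ + 8 * ‖θ‖ ^ 2) * ‖t • x‖ =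
        t * (homCos θ α x + (1 + ‖θ‖ + 8 * ‖θ‖ ^ 2) * ‖x‖) := by
    intro t ht x
    rw [homCos_smul θ α ht, norm_smul, Real.norm_of_nonneg ht]
    ring
  refine ⟨⟨convex_univ, fun x _ y _ a b ha hb _ => ?_⟩, hhom⟩
  have h := homCos_add_norm_subadditive θ α (a • x) (b • y)
  rwa [hhom a ha, hhom b hb] at h

/-- The norm-weighted angular part of `μ`. -/
def angularMeasure {d : ℕ} (μ : Measure (Ed d)) : Measure (Ed d) :=
  (μ.withDensity fun x => (‖x‖₊ : ℝ≥0∞)).map fun x => ‖x‖⁻¹ • x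

lemma integral_angularMeasure {d : ℕ} (μ : Measure (Ed d)) {f : Ed d → ℝ} (hf : Measurable f) :
    ∫ x, f x ∂angularMeasure μ = ∫ x, ‖x‖ * f (‖x‖⁻¹ • x) ∂μ := by
  rw [angularMeasure, integral_map (by fun_prop) hf.aestronglyMeasurable,
    integral_withDensity_eq_integral_smul measurable_nnnorm]
  rfl

lemma isFiniteMeasure_angularMeasure {d : ℕ} {μ : Measure (Ed d)}
    (hμ : Integrable (fun x => ‖x‖) μ) : IsFiniteMeasure (angularMeasure μ) := by
  have : IsFiniteMeasure (μ.withDensity fun x => (‖x‖₊ : ℝ≥0∞)) := by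
    refine isFiniteMeasure_withDensity ?_
    have := hμ.2.ne
    simpa [enorm_eq_nnnorm] using this
  unfold angularMeasure
  infer_instance

lemma measurable_homCos {d : ℕ} (θ : Ed d) (α : ℝ) : Measurable (homCos θ α) := by
  unfold homCos
  fun_prop

lemma integrable_homCos {d : ℕ} {μ : Measure (Ed d)} (hμ : Integrable (fun x => ‖x‖) μ)
    (θ : Ed d) (α : ℝ) : Integrable (homCos θ α) μ :=
  hμ.mono' (measurable_homCos θ α).aestronglyMeasurable (.of_forall (abs_homCos_le θ α))

lemma PHC.integral_homCos_le {d : ℕ} {μ ν : Measure (Ed d)}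
    (hμ : Integrable (fun x => ‖x‖) μ) (hν : Integrable (fun x => ‖x‖) ν)
    (hle : PHC μ ν) (heq : ∫ x, ‖x‖ ∂μ = ∫ x, ‖x‖ ∂ν) (θ : Ed d) (α : ℝ) :
    ∫ x, homCos θ α x ∂μ ≤ ∫ x, homCos θ α x ∂ν := by
  have h := hle _ (isSupportFunction_homCos_add_norm θ α)
  rw [integral_add (integrable_homCos hμ θ α) (hμ.const_mul _),
    integral_add (integrable_homCos hν θ α) (hν.const_mul _),
    integral_const_mul, integral_const_mul, heq] at h
  linarith

lemma PHC.integral_homCos_eq {d : ℕ} {μ ν : Measure (Ed d)}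
    (hμ : Integrable (fun x => ‖x‖) μ) (hν : Integrable (fun x => ‖x‖) ν)
    (hle : PHC μ ν) (heq : ∫ x, ‖x‖ ∂μ = ∫ x, ‖x‖ ∂ν) (θ : Ed d) (α : ℝ) :
    ∫ x, homCos θ α x ∂μ = ∫ x, homCos θ α x ∂ν := by
  refine le_antisymm (hle.integral_homCos_le hμ hν heq θ α) ?_
  have h := hle.integral_homCos_le hμ hν heq θ (α + Real.pi)
  have hneg : ∀ x : Ed d, homCos θ (α + Real.pi) x = -homCos θ α x := fun x => by
    rw [homCos, homCos, ← add_assoc, Real.cos_add_pi, mul_neg]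
  simp only [hneg, integral_neg] at h
  linarith

lemma charFun_eq_integral_cos {d : ℕ} (σ : Measure (Ed d)) [IsFiniteMeasure σ] (θ : Ed d) :
    charFun σ θ = (∫ x, Real.cos (⟪x, θ⟫ + 0) ∂σ : ℝ) -
      (∫ x, Real.cos (⟪x, θ⟫ + Real.pi / 2) ∂σ : ℝ) * Complex.I := by
  have hint : ∀ α : ℝ, Integrable (fun x : Ed d => (Real.cos (⟪x, θ⟫ + α) : ℂ)) σ := fun α =>
    Integrable.of_bound (by fun_prop) 1 (.of_forall fun x => by
      rw [Complex.norm_real]; exact Real.abs_cos_le_one _)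
  rw [charFun_apply, ← integral_complex_ofReal, ← integral_complex_ofReal, ← integral_mul_const,
    ← integral_sub (hint _) ((hint _).mul_const _)]
  congr 1 with x
  rw [Complex.exp_mul_I, Real.cos_add_pi_div_two]
  push_cast
  simp

lemma PHC.angularMeasure_eq {d : ℕ} {μ ν : Measure (Ed d)}
    (hμ : Integrable (fun x => ‖x‖) μ) (hν : Integrable (fun x => ‖x‖) ν)
    (hle : PHC μ ν) (heq : ∫ x, ‖x‖ ∂μ = ∫ x, ‖x‖ ∂ν) :
    angularMeasure μ = angularMeasure ν := by
  have := isFiniteMeasure_angularMeasure hμ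
  have := isFiniteMeasure_angularMeasure hν
  refine Measure.ext_of_charFun (funext fun θ => ?_)
  have h : ∀ α : ℝ, ∫ x, Real.cos (⟪x, θ⟫ + α) ∂angularMeasure μ =
      ∫ x, Real.cos (⟪x, θ⟫ + α) ∂angularMeasure ν := fun α => by
    rw [integral_angularMeasure μ (by fun_prop), integral_angularMeasure ν (by fun_prop)]
    exact hle.integral_homCos_eq hμ hν heq θ α
  rw [charFun_eq_integral_cos, charFun_eq_integral_cos, h, h]

lemma PosHomogeneous.integral_eq_integral_angularMeasure {d : ℕ} {f : Ed d → ℝ}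
    (hf : PosHomogeneous f) (hfm : Measurable f) (μ : Measure (Ed d)) :
    ∫ x, f x ∂μ = ∫ x, f x ∂angularMeasure μ := by
  rw [integral_angularMeasure μ hfm]
  congr 1 with x
  rw [← hf _ (norm_nonneg x)]
  rcases eq_or_ne x 0 with rfl | hx
  · simp
  · rw [smul_inv_smul₀ (norm_ne_zero_iff.2 hx)]

/-- If `μ ≼phc ν` and both measures give the same integral to the norm, then `μ ≡ph ν`. -/
theorem eqPH_of_phc_of_integral_norm_eq {d : ℕ}
    (μ ν : Measure (Ed d)) [IsFiniteMeasure μ] [IsFiniteMeasure ν]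
    (hμ : Integrable (fun x => ‖x‖) μ) (hν : Integrable (fun x => ‖x‖) ν)
    (hle : PHC μ ν)
    (heq : ∫ x, ‖x‖ ∂μ = ∫ x, ‖x‖ ∂ν) :
    EqPH μ ν := by
  intro f hfm hf _
  rw [hf.integral_eq_integral_angularMeasure hfm μ, hf.integral_eq_integral_angularMeasure hfm ν,
    hle.angularMeasure_eq hμ hν heq]
end
end

section
/- Let μ be a compactly supported finite nonnegative Borel measure on ℝ^d with μ(ℝ^d) > 0. Then there exists a sequence (μₙ) of finitely supported nonnegative measures on ℝ^d satisfying μₙ ≼phc μ and μₙ(ℝ^d) = μ(ℝ^d) for all n, such that the 1-Wasserstein distance W₁(μₙ/μₙ(ℝ^d), μ/μ(ℝ^d)) tends to 0 as n → ∞. -/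
open MeasureTheory Filter
open scoped ENNReal NNReal

noncomputable section

/-- The 1-Wasserstein distance (as an extended nonnegative real): infimum over couplings
of the integral of the Euclidean distance; `⊤` if no coupling exists. -/
def W1 {d : ℕ} (ρ σ : Measure (Ed d)) : ℝ≥0∞ :=
  ⨅ (π : Measure (Ed d × Ed d)) (_ : π.map Prod.fst = ρ ∧ π.map Prod.snd = σ),
    ∫⁻ p, (‖p.1 - p.2‖₊ : ℝ≥0∞) ∂π

/-- A compactly supported finite measure integrates every continuous function. -/
theorem integrable_of_continuous_of_compact_compl_null {d : ℕ} {F : Type*}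
    [NormedAddCommGroup F] {μ : Measure (Ed d)} [IsFiniteMeasure μ] {K : Set (Ed d)}
    (hK : IsCompact K) (hμK : μ Kᶜ = 0) {f : Ed d → F} (hf : Continuous f) :
    Integrable f μ := by
  have h : IntegrableOn f K μ := hf.continuousOn.integrableOn_compact hK
  rwa [IntegrableOn, Measure.restrict_eq_self_of_ae_mem (mem_ae_iff.2 hμK)] at h

/-- The identity is uniformly approximated on a compact set by a simple function. -/
theorem exists_simpleFunc_dist_le {d : ℕ} {K : Set (Ed d)} (hK : IsCompact K) {ε : ℝ}
    (hε : 0 < ε) : ∃ g : SimpleFunc (Ed d) (Ed d), ∀ x ∈ K, dist (g x) x ≤ ε := by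
  let e := TopologicalSpace.denseSeq (Ed d)
  obtain ⟨t, ht⟩ := hK.elim_finite_subcover (fun k => Metric.ball (e k) ε)
    (fun _ => Metric.isOpen_ball) fun x _ => by
      obtain ⟨k, hk⟩ := (TopologicalSpace.denseRange_denseSeq (Ed d)).exists_dist_lt x hε
      exact Set.mem_iUnion.2 ⟨k, hk⟩
  refine ⟨SimpleFunc.nearestPt e (t.sup id), fun x hx => ?_⟩
  obtain ⟨k, hk, hxk⟩ := Set.mem_iUnion₂.1 (ht hx)
  have h := SimpleFunc.edist_nearestPt_le e x (Finset.le_sup (f := id) hk)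
  rw [edist_dist, edist_dist, ENNReal.ofReal_le_ofReal_iff dist_nonneg] at h
  exact h.trans (by rw [dist_comm]; exact (Metric.mem_ball.1 hxk).le)

/-- The simple function sending each point to the `μ`-barycenter of its fiber under `g`. -/
def fiberBarycenter {d : ℕ} (μ : Measure (Ed d)) (g : SimpleFunc (Ed d) (Ed d)) :
    SimpleFunc (Ed d) (Ed d) :=
  g.map fun c => ⨍ y in g ⁻¹' {c}, y ∂μ

/-- Integration over the fibers of a simple function. -/
theorem integral_eq_sum_fibers {d : ℕ} {μ : Measure (Ed d)} (g : SimpleFunc (Ed d) (Ed d))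
    {f : Ed d → ℝ} (hf : Integrable f μ) :
    ∫ x, f x ∂μ = ∑ c ∈ g.range, ∫ x in g ⁻¹' {c}, f x ∂μ := by
  rw [← integral_biUnion_finset g.range (fun c _ => g.measurableSet_fiber c)
    (fun a _ b _ hab => (Set.disjoint_singleton.2 hab).preimage g) fun _ _ => hf.integrableOn]
  rw [show (⋃ c ∈ g.range, g ⁻¹' {c}) = Set.univ from
    Set.eq_univ_of_forall fun x => Set.mem_iUnion₂.2 ⟨g x, g.mem_range_self x, rfl⟩,
    setIntegral_univ]

/-- Jensen's inequality for collapsing fibers to their barycenters. -/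
theorem integral_fiberBarycenter_le {d : ℕ} {μ : Measure (Ed d)} [IsFiniteMeasure μ]
    (g : SimpleFunc (Ed d) (Ed d)) {f : Ed d → ℝ} (hf : ConvexOn ℝ Set.univ f)
    (hfc : Continuous f) (hid : Integrable (fun x : Ed d => x) μ) (hfi : Integrable f μ) :
    ∫ x, f (fiberBarycenter μ g x) ∂μ ≤ ∫ x, f x ∂μ := by
  have hT : Integrable (fun x => f (fiberBarycenter μ g x)) μ :=
    ((fiberBarycenter μ g).map f).integrable_of_isFiniteMeasure
  rw [integral_eq_sum_fibers g hfi, integral_eq_sum_fibers g hT]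
  refine Finset.sum_le_sum fun c _ => ?_
  rcases eq_or_ne (μ (g ⁻¹' {c})) 0 with h0 | h0
  · simp [Measure.restrict_eq_zero.2 h0]
  have hconst : ∫ x in g ⁻¹' {c}, f (fiberBarycenter μ g x) ∂μ =
      μ.real (g ⁻¹' {c}) * f (⨍ y in g ⁻¹' {c}, y ∂μ) := by
    rw [setIntegral_congr_fun (g := fun _ => f (⨍ y in g ⁻¹' {c}, y ∂μ))
      (g.measurableSet_fiber c), setIntegral_const, smul_eq_mul]
    intro x hx
    have hx : g x = c := hx
    simp [fiberBarycenter, hx]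
  have hJ : f (⨍ y in g ⁻¹' {c}, y ∂μ) ≤ ⨍ y in g ⁻¹' {c}, f y ∂μ :=
    hf.map_set_average_le hfc.continuousOn isClosed_univ h0 (measure_ne_top _ _)
      (by simp) hid.integrableOn hfi.integrableOn
  rw [hconst, ← measure_smul_setAverage f (measure_ne_top μ _), smul_eq_mul]
  exact mul_le_mul_of_nonneg_left hJ measureReal_nonneg

/-- Collapsing fibers to barycenters moves points by at most twice the approximation error. -/
theorem ae_dist_fiberBarycenter_le {d : ℕ} {μ : Measure (Ed d)} [IsFiniteMeasure μ]
    (g : SimpleFunc (Ed d) (Ed d)) (hid : Integrable (fun x : Ed d => x) μ) {ε : ℝ}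
    (hg : ∀ᵐ x ∂μ, dist (g x) x ≤ ε) :
    ∀ᵐ x ∂μ, dist (fiberBarycenter μ g x) x ≤ 2 * ε := by
  have hnull : ∀ᵐ x ∂μ, ∀ c ∈ g.range, μ (g ⁻¹' {c}) = 0 → x ∉ g ⁻¹' {c} := by
    refine (ae_ball_iff g.range.countable_toSet).2 fun c _ => ?_
    by_cases h0 : μ (g ⁻¹' {c}) = 0
    · filter_upwards [measure_eq_zero_iff_ae_notMem.1 h0] with x hx _ using hx
    · exact Eventually.of_forall fun _ h => absurd h h0
  filter_upwards [hg, hnull] with x hx hxn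
  have h0 : μ (g ⁻¹' {g x}) ≠ 0 := fun h => hxn (g x) (g.mem_range_self x) h rfl
  have hmem : (⨍ y in g ⁻¹' {g x}, y ∂μ) ∈ Metric.closedBall (g x) ε := by
    refine (convex_closedBall (g x) ε).set_average_mem Metric.isClosed_closedBall h0
      (measure_ne_top _ _) ?_ hid.integrableOn
    filter_upwards [ae_restrict_of_ae hg, ae_restrict_mem (g.measurableSet_fiber (g x))]
      with y hy hyc
    have hyc : g y = g x := hyc
    rwa [Metric.mem_closedBall, dist_comm, ← hyc]
  calc dist (fiberBarycenter μ g x) x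
      ≤ dist (fiberBarycenter μ g x) (g x) + dist (g x) x := dist_triangle _ _ _
    _ ≤ 2 * ε := by
        have : dist (fiberBarycenter μ g x) (g x) ≤ ε := hmem
        linarith

/-- A map displacing points by at most `ε` moves the normalized measure by at most `ε`
in the Wasserstein distance. -/
theorem W1_map_le {d : ℕ} {μ : Measure (Ed d)} [IsFiniteMeasure μ] {T : Ed d → Ed d}
    (hT : Measurable T) {ε : ℝ} (hTε : ∀ᵐ x ∂μ, dist (T x) x ≤ ε) :
    W1 ((μ Set.univ)⁻¹ • μ.map T) ((μ Set.univ)⁻¹ • μ) ≤ ENNReal.ofReal ε := by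
  have hm : Measurable fun x => (T x, x) := hT.prodMk measurable_id
  have hfst : ((μ Set.univ)⁻¹ • μ.map fun x => (T x, x)).map Prod.fst =
      (μ Set.univ)⁻¹ • μ.map T := by
    rw [Measure.map_smul, Measure.map_map measurable_fst hm]; rfl
  have hsnd : ((μ Set.univ)⁻¹ • μ.map fun x => (T x, x)).map Prod.snd =
      (μ Set.univ)⁻¹ • μ := by
    rw [Measure.map_smul, Measure.map_map measurable_snd hm]
    exact congrArg _ Measure.map_id
  refine (iInf₂_le _ ⟨hfst, hsnd⟩).trans ?_
  rw [lintegral_smul_measure, lintegral_map (by fun_prop) hm, smul_eq_mul]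
  calc (μ Set.univ)⁻¹ * ∫⁻ x, (‖T x - x‖₊ : ℝ≥0∞) ∂μ
      ≤ (μ Set.univ)⁻¹ * ∫⁻ _, ENNReal.ofReal ε ∂μ := by
        gcongr 1
        refine lintegral_mono_ae ?_
        filter_upwards [hTε] with x hx
        rw [← enorm_eq_nnnorm, ← ofReal_norm, ← dist_eq_norm]
        exact ENNReal.ofReal_le_ofReal hx
    _ = ENNReal.ofReal ε * ((μ Set.univ)⁻¹ * μ Set.univ) := by
        rw [lintegral_const]; ring
    _ ≤ ENNReal.ofReal ε * 1 := by gcongr; exact ENNReal.inv_mul_le_one _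
    _ = ENNReal.ofReal ε := mul_one _

/-- A compactly supported finite measure `μ` of positive mass can be approximated in `W₁`
(after normalization) by finitely supported measures of the same total mass lying below it
in the `≼phc` order. -/
theorem exists_finitelySupported_phc_approximation {d : ℕ}
    (μ : Measure (Ed d)) [IsFiniteMeasure μ]
    (hK : ∃ K : Set (Ed d), IsCompact K ∧ μ Kᶜ = 0)
    (hpos : 0 < μ Set.univ) :
    ∃ μs : ℕ → Measure (Ed d),
      (∀ n, ∃ s : Finset (Ed d), μs n (↑s : Set (Ed d))ᶜ = 0) ∧
      (∀ n, PHC (μs n) μ) ∧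
      (∀ n, μs n Set.univ = μ Set.univ) ∧
      Filter.Tendsto
        (fun n => W1 ((μs n Set.univ)⁻¹ • μs n) ((μ Set.univ)⁻¹ • μ))
        Filter.atTop (nhds 0) := by
  obtain ⟨K, hK, hμK⟩ := hK
  have hid : Integrable (fun x : Ed d => x) μ :=
    integrable_of_continuous_of_compact_compl_null hK hμK continuous_id
  choose g hg using fun n : ℕ => exists_simpleFunc_dist_le hK (Nat.one_div_pos_of_nat (n := n))
  let T := fun n => fiberBarycenter μ (g n)
  have hTm : ∀ n, Measurable (T n) := fun n => (T n).measurable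
  have hmass : ∀ n, μ.map (T n) Set.univ = μ Set.univ := fun n => by
    rw [Measure.map_apply (hTm n) MeasurableSet.univ, Set.preimage_univ]
  refine ⟨fun n => μ.map (T n), fun n => ⟨(T n).range, ?_⟩, fun n f hf => ?_, hmass, ?_⟩
  · rw [Measure.map_apply (hTm n) (Finset.measurableSet _).compl, Set.preimage_compl,
      Set.eq_univ_of_forall (s := T n ⁻¹' (T n).range) fun x => (T n).mem_range_self x, Set.compl_univ,
      measure_empty]
  · have hfc : Continuous f := continuousOn_univ.1 (hf.1.continuousOn isOpen_univ)
    rw [integral_map (hTm n).aemeasurable hfc.aestronglyMeasurable]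
    exact integral_fiberBarycenter_le (g n) hf.1 hfc hid
      (integrable_of_continuous_of_compact_compl_null hK hμK hfc)
  · have hbound : ∀ n, W1 ((μ.map (T n) Set.univ)⁻¹ • μ.map (T n)) ((μ Set.univ)⁻¹ • μ) ≤
        ENNReal.ofReal (2 * (1 / ((n : ℝ) + 1))) := fun n => by
      rw [hmass n]
      refine W1_map_le (hTm n) (ae_dist_fiberBarycenter_le (g n) hid ?_)
      filter_upwards [mem_ae_iff.2 hμK] with x hx using hg n x hx
    refine tendsto_of_tendsto_of_tendsto_of_le_of_le tendsto_const_nhds ?_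
      (fun _ => zero_le) hbound
    simpa using ENNReal.tendsto_ofReal
      ((tendsto_one_div_add_atTop_nhds_zero_nat (𝕜 := ℝ)).const_mul 2)
end
end

section
/- Let μ and ν be finite nonnegative Borel measures on ℝ^d with finite first moments, and suppose ν has compact support. Let (qₙ) be a sequence of unnormalized kernels each transporting μ to a measure ρₙ ≤ ν (i.e. ν − ρₙ is a nonnegative measure). Then there exist kernels rₙ, each a finite convex combination of the kernels {q_j : j ≥ n}, and an unnormalized kernel r transporting μ to some measure ρ ≤ ν, such that for μ-a.e. x the measures rₙ^x converge weakly to r^x. -/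
open MeasureTheory Filter
open scoped ENNReal NNReal

noncomputable section

/-- The weights of a finite convex combination of the indices `j ≥ n`. -/
def tailWeights (n : ℕ) : Set (ℕ →₀ ℝ≥0) :=
  {a | a ∈ Finsupp.supported ℝ≥0 ℝ≥0 (Set.Ici n) ∧
    Finsupp.linearCombination ℝ≥0 (fun _ => (1 : ℝ≥0)) a = 1}

lemma tailWeights_anti : Antitone tailWeights := fun _ _ hnm _ ha =>
  ⟨Finsupp.supported_mono (Set.Ici_subset_Ici.2 hnm) ha.1, ha.2⟩

lemma single_mem_tailWeights (n : ℕ) : Finsupp.single n 1 ∈ tailWeights n :=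
  ⟨Finsupp.single_mem_supported _ _ (Set.mem_Ici.2 le_rfl), by simp⟩

lemma midpoint_mem_tailWeights {n : ℕ} {a b : ℕ →₀ ℝ≥0} (ha : a ∈ tailWeights n)
    (hb : b ∈ tailWeights n) : (2⁻¹ : ℝ≥0) • (a + b) ∈ tailWeights n :=
  ⟨Submodule.smul_mem _ _ (Submodule.add_mem _ ha.1 hb.1), by
    rw [map_smul, map_add, ha.2, hb.2, smul_eq_mul, one_add_one_eq_two]
    exact inv_mul_cancel₀ two_ne_zero⟩

lemma linearCombination_nnreal_apply {X : Type*} (f : ℕ → X → ℝ≥0) (a : ℕ →₀ ℝ≥0) (x : X) :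
    Finsupp.linearCombination ℝ≥0 f a x = ∑ j ∈ a.support, a j * f j x := by
  simp [Finsupp.linearCombination_apply, Finsupp.sum]

lemma exists_tendsto_coe_of_tendsto_exp_neg_half {t : ℕ → ℝ≥0} {v : ℝ}
    (h : Tendsto (fun n => Real.exp (-(t n : ℝ) / 2)) atTop (nhds v)) :
    ∃ L : ℝ≥0∞, Tendsto (fun n => (t n : ℝ≥0∞)) atTop (nhds L) := by
  have hv : 0 ≤ v := ge_of_tendsto' h fun n => (Real.exp_pos _).le
  have key : (fun n => (t n : ℝ≥0∞)) = fun n => ENNReal.ofReal (t n : ℝ) := by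
    ext n; simp
  rw [key]
  rcases hv.eq_or_lt with rfl | hv
  · refine ⟨∞, ENNReal.tendsto_ofReal_atTop.comp ?_⟩
    have h1 : Tendsto (fun n => -(t n : ℝ) / 2) atTop atBot :=
      Real.tendsto_exp_comp_nhds_zero.1 h
    have h2 := h1.const_mul_atBot_of_neg (r := -2) (by norm_num)
    refine h2.congr fun n => by ring
  · refine ⟨ENNReal.ofReal (-2 * Real.log v), ENNReal.tendsto_ofReal ?_⟩
    have h1 := ((Real.continuousAt_log hv.ne').tendsto.comp h).const_mul (-2)
    refine h1.congr fun n => ?_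
    simp only [Function.comp_apply, Real.log_exp]
    ring

section

variable {X : Type*} [MeasurableSpace X] {m : Measure X}

lemma dist_toLp_two_sq {u v : X → ℝ} (hu : MemLp u 2 m) (hv : MemLp v 2 m) :
    dist (hu.toLp u) (hv.toLp v) ^ 2 = ∫ x, (u x - v x) ^ 2 ∂m := by
  rw [dist_eq_norm, ← MemLp.toLp_sub, ← real_inner_self_eq_norm_sq, L2.inner_def]
  refine integral_congr_ae ?_
  filter_upwards [(hu.sub hv).coeFn_toLp] with x hx
  simp [hx, pow_two]

lemma measurable_linearCombination {f : ℕ → X → ℝ≥0} (hf : ∀ n, Measurable (f n))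
    (a : ℕ →₀ ℝ≥0) : Measurable (Finsupp.linearCombination ℝ≥0 f a) := by
  rw [funext (linearCombination_nnreal_apply f a)]
  exact Finset.measurable_sum _ fun j _ => (hf j).const_mul (a j)

/-- Nonnegative measurable functions on a finite measure space admit forward convex combinations
converging almost everywhere to a limit in `[0, ∞]`. -/
lemma exists_tailWeights_tendsto_ae [IsFiniteMeasure m] {f : ℕ → X → ℝ≥0}
    (hf : ∀ n, Measurable (f n)) :
    ∃ a : ℕ → ℕ →₀ ℝ≥0, (∀ n, a n ∈ tailWeights n) ∧
      ∀ᵐ x ∂m, ∃ L : ℝ≥0∞,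
        Tendsto (fun n => (Finsupp.linearCombination ℝ≥0 f (a n) x : ℝ≥0∞)) atTop (nhds L) := by
  set H : (ℕ →₀ ℝ≥0) → X → ℝ≥0 := fun a => Finsupp.linearCombination ℝ≥0 f a with hH
  have Hm a : Measurable (H a) := measurable_linearCombination hf a
  have int1 (g : X → ℝ) (hg : Measurable g) (hg0 : ∀ x, 0 ≤ g x) :
      MemLp (fun x => Real.exp (-g x)) 2 m := by
    refine MemLp.of_bound (by fun_prop) 1 (ae_of_all _ fun x => ?_)
    rw [Real.norm_eq_abs, Real.abs_exp, Real.exp_le_one_iff]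
    linarith [hg0 x]
  have hu a : MemLp (fun x => Real.exp (-(H a x : ℝ) / 2)) 2 m := by
    simpa only [neg_div] using int1 (fun x => (H a x : ℝ) / 2)
      ((Hm a).coe_nnreal_real.div_const 2) fun x => by positivity
  have hi a : Integrable (fun x => Real.exp (-(H a x : ℝ))) m :=
    (int1 (fun x => (H a x : ℝ)) (Hm a).coe_nnreal_real fun x => by positivity).integrable
      (by norm_num)
  set Φ : (ℕ →₀ ℝ≥0) → ℝ := fun a => ∫ x, Real.exp (-(H a x : ℝ)) ∂m with hΦ
  have Φ0 a : 0 ≤ Φ a := integral_nonneg fun x => (Real.exp_pos _).le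
  have Φ1 a : Φ a ≤ m.real Set.univ := by
    calc Φ a ≤ ∫ _, (1 : ℝ) ∂m := by
          refine integral_mono (hi a) (integrable_const _) fun x => ?_
          simp
      _ = _ := by simp
  have hdist a b : ∫ x, (Real.exp (-(H a x : ℝ) / 2) - Real.exp (-(H b x : ℝ) / 2)) ^ 2 ∂m
      = Φ a + Φ b - 2 * Φ ((2⁻¹ : ℝ≥0) • (a + b)) := by
    rw [hΦ]
    dsimp only
    rw [← integral_add (hi a) (hi b), ← integral_const_mul]
    refine Eq.trans ?_ (integral_sub ((hi a).add (hi b)) ((hi _).const_mul 2))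
    refine integral_congr_ae (ae_of_all _ fun x => ?_)
    have h1 : (H ((2⁻¹ : ℝ≥0) • (a + b)) x : ℝ) = (H a x + H b x) / 2 := by
      simp only [hH, map_smul, map_add, Pi.smul_apply, Pi.add_apply, smul_eq_mul]
      push_cast
      ring
    have e (t : ℝ) : Real.exp (-t) = Real.exp (-t / 2) ^ 2 := by
      rw [← Real.exp_nat_mul]; congr 1; push_cast; ring
    have e2 : Real.exp (-((H a x + H b x : ℝ) / 2))
        = Real.exp (-(H a x : ℝ) / 2) * Real.exp (-(H b x : ℝ) / 2) := by
      rw [← Real.exp_add]; congr 1; ring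
    dsimp only [Pi.add_apply]
    rw [h1, e2, e (H a x), e (H b x)]
    ring
  set I : ℕ → ℝ := fun n => sInf (Φ '' tailWeights n) with hI
  have bdd n : BddBelow (Φ '' tailWeights n) := ⟨0, by rintro _ ⟨a, -, rfl⟩; exact Φ0 a⟩
  have ne n : (Φ '' tailWeights n).Nonempty := ⟨_, _, single_mem_tailWeights n, rfl⟩
  have Imono : Monotone I := fun n k hnk =>
    csInf_le_csInf (bdd n) (ne k) (Set.image_mono (tailWeights_anti hnk))
  have Ibdd : BddAbove (Set.range I) := ⟨m.real Set.univ, by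
    rintro _ ⟨n, rfl⟩
    exact (csInf_le (bdd n) ⟨_, single_mem_tailWeights n, rfl⟩).trans (Φ1 _)⟩
  have Ilim := tendsto_atTop_ciSup Imono Ibdd
  have hex n : ∃ a ∈ tailWeights n, Φ a < I n + 1 / ((n : ℝ) + 1) := by
    obtain ⟨_, ⟨a, ha, rfl⟩, h⟩ := exists_lt_of_csInf_lt (ne n)
      (show sInf (Φ '' tailWeights n) < I n + 1 / ((n : ℝ) + 1) from
        lt_add_of_pos_right _ (by positivity))
    exact ⟨a, ha, h⟩
  choose a ha haΦ using hex
  have hcauchy : CauchySeq fun n => (hu (a n)).toLp _ := by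
    refine cauchySeq_of_le_tendsto_0'
      (fun n => Real.sqrt ((⨆ k, I k) - I n + 2 * (1 / ((n : ℝ) + 1)))) (fun n k hnk => ?_) ?_
    · refine Real.le_sqrt_of_sq_le ?_
      rw [dist_toLp_two_sq, hdist]
      have h1 := csInf_le (bdd n)
        ⟨_, midpoint_mem_tailWeights (ha n) (tailWeights_anti hnk (ha k)), rfl⟩
      have h2 : I k ≤ ⨆ k, I k := le_ciSup Ibdd k
      have h3 : 1 / ((k : ℝ) + 1) ≤ 1 / ((n : ℝ) + 1) := by gcongr
      have h4 := haΦ n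
      have h5 := haΦ k
      change I n ≤ _ at h1
      linarith
    · have h1 := ((tendsto_const_nhds (x := ⨆ k, I k)).sub Ilim).add
        ((tendsto_one_div_add_atTop_nhds_zero_nat (𝕜 := ℝ)).const_mul 2)
      simpa using h1.sqrt
  obtain ⟨U, hU⟩ := cauchySeq_tendsto_of_complete hcauchy
  obtain ⟨ns, hns, hae⟩ := (tendstoInMeasure_of_tendsto_Lp hU).exists_seq_tendsto_ae
  refine ⟨fun n => a (ns n), fun n => tailWeights_anti hns.le_apply (ha _), ?_⟩
  have hall : ∀ᵐ x ∂m, ∀ n, (hu (a n)).toLp _ x = Real.exp (-(H (a n) x : ℝ) / 2) :=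
    ae_all_iff.2 fun n => (hu (a n)).coeFn_toLp
  filter_upwards [hae, hall] with x hx hx'
  refine exists_tendsto_coe_of_tendsto_exp_neg_half (v := U x) (hx.congr fun n => hx' _)

end

lemma lintegral_sum_smul_measure {Y : Type*} [MeasurableSpace Y] (s : Finset ℕ) (w : ℕ → ℝ≥0)
    (m : ℕ → Measure Y) (g : Y → ℝ≥0∞) :
    ∫⁻ y, g y ∂(∑ j ∈ s, (w j : ℝ≥0∞) • m j) = ∑ j ∈ s, (w j : ℝ≥0∞) * ∫⁻ y, g y ∂(m j) := by
  simp only [lintegral_finsetSum_measure, lintegral_smul_measure, smul_eq_mul]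

lemma isFiniteMeasure_sum_smul {Y : Type*} [MeasurableSpace Y] (s : Finset ℕ) (w : ℕ → ℝ≥0)
    (m : ℕ → Measure Y) [∀ j, IsFiniteMeasure (m j)] :
    IsFiniteMeasure (∑ j ∈ s, (w j : ℝ≥0∞) • m j) := by
  refine ⟨?_⟩
  rw [Measure.finsetSum_apply]
  exact ENNReal.sum_lt_top.2 fun j _ => ENNReal.mul_lt_top ENNReal.coe_lt_top (measure_lt_top _ _)

lemma sum_tailWeights {n : ℕ} {a : ℕ →₀ ℝ≥0} (ha : a ∈ tailWeights n) :
    ∑ j ∈ a.support, a j = 1 := by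
  simpa [Finsupp.linearCombination_apply, Finsupp.sum] using ha.2

lemma lintegral_sum_tailWeights_le {Ω : Type*} [MeasurableSpace Ω] {μ : Measure Ω} {n : ℕ}
    {a : ℕ →₀ ℝ≥0} (ha : a ∈ tailWeights n) {F : ℕ → Ω → ℝ≥0∞} (hF : ∀ j, Measurable (F j))
    {C : ℝ≥0∞} (hC : ∀ j, ∫⁻ x, F j x ∂μ ≤ C) :
    ∫⁻ x, ∑ j ∈ a.support, (a j : ℝ≥0∞) * F j x ∂μ ≤ C := by
  rw [lintegral_finsetSum _ fun j _ => (hF j).const_mul _]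
  calc ∑ j ∈ a.support, ∫⁻ x, (a j : ℝ≥0∞) * F j x ∂μ
      ≤ ∑ j ∈ a.support, (a j : ℝ≥0∞) * C := by
        refine Finset.sum_le_sum fun j _ => ?_
        rw [lintegral_const_mul _ (hF j)]
        gcongr
        exact hC j
    _ = C := by
        rw [← Finset.sum_mul, ← ENNReal.ofNNReal_finsetSum, sum_tailWeights ha, ENNReal.coe_one,
          one_mul]

lemma lintegral_liminf_tailWeights_le {Ω : Type*} [MeasurableSpace Ω] {μ : Measure Ω}
    {a : ℕ → ℕ →₀ ℝ≥0} (ha : ∀ n, a n ∈ tailWeights n) {F : ℕ → Ω → ℝ≥0∞}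
    (hF : ∀ j, Measurable (F j)) {C : ℝ≥0∞} (hC : ∀ j, ∫⁻ x, F j x ∂μ ≤ C) :
    ∫⁻ x, liminf (fun n => ∑ j ∈ (a n).support, (a n j : ℝ≥0∞) * F j x) atTop ∂μ ≤ C := by
  refine (lintegral_liminf_le fun n =>
    Finset.measurable_sum _ fun j _ => (hF j).const_mul _).trans ?_
  refine liminf_le_of_le (by isBoundedDefault) fun b hb => ?_
  obtain ⟨n, hn⟩ := hb.exists
  exact hn.trans (lintegral_sum_tailWeights_le (ha n) hF hC)

section

open BoundedContinuousFunction

variable {Y : Type*} [TopologicalSpace Y] [MeasurableSpace Y] [BorelSpace Y]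

/-- Finite measures on a compact space converge weakly as soon as their integrals against a dense
family of test functions converge. -/
lemma exists_tendsto_finiteMeasure_of_denseRange [CompactSpace Y] [T2Space Y]
    [HasOuterApproxClosed Y] {G : ℕ → Y →ᵇ ℝ≥0} (hG : DenseRange G) {M : ℕ → FiniteMeasure Y}
    (h : ∀ k, ∃ L : ℝ≥0, Tendsto (fun n => (M n).testAgainstNN (G k)) atTop (nhds L)) :
    ∃ M' : FiniteMeasure Y, Tendsto M atTop (nhds M') := by
  obtain ⟨k, hk⟩ := hG.exists_dist_lt (const Y (1 : ℝ≥0)) (ε := 1 / 2) (by norm_num)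
  have hGk : ⇑(const Y (1 / 2 : ℝ≥0)) ≤ ⇑(G k) := fun y => by
    have h1 := (dist_coe_le_dist y).trans_lt hk
    rw [NNReal.dist_eq, abs_lt] at h1
    have h2 : ((const Y (1 : ℝ≥0) y : ℝ≥0) : ℝ) = 1 := by simp
    rw [← NNReal.coe_le_coe]
    simp only [const_apply]
    push_cast
    linarith [h1.2]
  obtain ⟨L₀, hL₀⟩ := h k
  obtain ⟨B, hB⟩ := hL₀.bddAbove_range
  have hmass n : (M n).mass ≤ 2 * B := by
    have h1 := ((M n).testAgainstNN_mono hGk).trans (hB ⟨n, rfl⟩)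
    rw [FiniteMeasure.testAgainstNN_const] at h1
    calc (M n).mass = 2 * (1 / 2 * (M n).mass) := by
          rw [← mul_assoc]; simp
      _ ≤ 2 * B := by gcongr
  have hcpt := isCompact_setOfPred_finiteMeasure_le_of_compactSpace Y (2 * B)
  have hlim (y : FiniteMeasure Y) (hy : MapClusterPt y atTop M) (k : ℕ) (L : ℝ≥0)
      (hL : Tendsto (fun n => (M n).testAgainstNN (G k)) atTop (nhds L)) :
      y.testAgainstNN (G k) = L := by
    obtain ⟨U, hU, hyU⟩ := mapClusterPt_iff_ultrafilter.1 hy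
    exact tendsto_nhds_unique
      (((FiniteMeasure.continuous_testAgainstNN_eval (G k)).tendsto y).comp hyU) (hL.mono_left hU)
  obtain ⟨y, -, hy⟩ := hcpt.exists_mapClusterPt (f := atTop) (u := M)
    (tendsto_principal.2 (Eventually.of_forall hmass))
  refine ⟨y, hcpt.tendsto_nhds_of_unique_mapClusterPt (Eventually.of_forall hmass)
    fun z _ hz => ?_⟩
  have heq : z.testAgainstNN = y.testAgainstNN := by
    refine hG.equalizer z.testAgainstNN_lipschitz.continuous y.testAgainstNN_lipschitz.continuous
      (funext fun k => ?_)
    obtain ⟨L, hL⟩ := h k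
    exact (hlim z hz k L hL).trans (hlim y hy k L hL).symm
  refine FiniteMeasure.toMeasure_injective
    (ext_of_forall_lintegral_eq_of_IsFiniteMeasure fun g => ?_)
  rw [← FiniteMeasure.testAgainstNN_coe_eq, ← FiniteMeasure.testAgainstNN_coe_eq, heq]

lemma measurable_of_measurable_lintegral_boundedContinuous {Ω : Type*} [MeasurableSpace Ω]
    [HasOuterApproxClosed Y] {η : Ω → Measure Y} [∀ x, IsFiniteMeasure (η x)]
    (h : ∀ g : Y →ᵇ ℝ≥0, Measurable fun x => ∫⁻ y, g y ∂(η x)) : Measurable η := by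
  have hclosed (F : Set Y) (hF : IsClosed F) : Measurable fun x => η x F :=
    ENNReal.measurable_of_tendsto (fun n => h (hF.apprSeq n)) (tendsto_pi_nhds.2 fun x =>
      HasOuterApproxClosed.tendsto_lintegral_apprSeq hF (η x))
  exact Measurable.measure_of_isPiSystem
    ((BorelSpace.measurable_eq (α := Y)).trans borel_eq_generateFrom_isClosed)
    isPiSystem_isClosed hclosed (hclosed _ isClosed_univ)

lemma measure_le_of_lintegral_boundedContinuous_le [TopologicalSpace.PseudoMetrizableSpace Y]
    {ρ ν : Measure Y} [IsFiniteMeasure ν]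
    (h : ∀ g : Y →ᵇ ℝ≥0, ∫⁻ y, g y ∂ρ ≤ ∫⁻ y, g y ∂ν) : ρ ≤ ν := by
  have hρ : IsFiniteMeasure ρ := ⟨by
    have h1 := h (const Y 1)
    simp only [const_apply, ENNReal.coe_one, lintegral_one] at h1
    exact h1.trans_lt (measure_lt_top _ _)⟩
  refine Measure.le_iff.2 fun A hA => ?_
  rw [hA.measure_eq_iSup_isClosed_of_ne_top (measure_ne_top ρ A)]
  refine iSup_le fun F => iSup_le fun hFA => iSup_le fun hF => ?_
  exact (le_of_tendsto_of_tendsto' (HasOuterApproxClosed.tendsto_lintegral_apprSeq hF ρ)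
    (HasOuterApproxClosed.tendsto_lintegral_apprSeq hF ν) fun n => h _).trans (measure_mono hFA)

lemma exists_denseRange_boundedContinuous (Y : Type*) [TopologicalSpace Y] [CompactSpace Y]
    [T2Space Y] [SecondCountableTopology Y] : ∃ G : ℕ → Y →ᵇ ℝ≥0, DenseRange G :=
  ⟨_, (ContinuousMap.isometryEquivBoundedOfCompact Y ℝ≥0).surjective.denseRange.comp
    (TopologicalSpace.denseRange_denseSeq C(Y, ℝ≥0))
    (ContinuousMap.isometryEquivBoundedOfCompact Y ℝ≥0).continuous⟩

/-- Kernels into a compact space with uniformly integrable bound on their masses admit forward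
convex combinations which converge weakly almost everywhere to a kernel. -/
lemma exists_tailWeights_tendsto_kernel {Ω : Type*} [MeasurableSpace Ω] {μ : Measure Ω}
    [SFinite μ] [CompactSpace Y] [T2Space Y] [SecondCountableTopology Y]
    {κ : ℕ → ProbabilityTheory.Kernel Ω Y} (hκ : ∀ n x, IsFiniteMeasure (κ n x)) {C : ℝ≥0∞}
    (hC : C ≠ ∞) (hκC : ∀ n, ∫⁻ x, κ n x Set.univ ∂μ ≤ C) :
    ∃ a : ℕ → ℕ →₀ ℝ≥0, (∀ n, a n ∈ tailWeights n) ∧ ∃ η : ProbabilityTheory.Kernel Ω Y,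
      (∀ x, IsFiniteMeasure (η x)) ∧ ∀ᵐ x ∂μ, ∀ g : Y →ᵇ ℝ≥0,
        Tendsto (fun n => ∑ j ∈ (a n).support, (a n j : ℝ≥0∞) * ∫⁻ y, g y ∂(κ j x)) atTop
          (nhds (∫⁻ y, g y ∂(η x))) := by
  obtain ⟨G, hG⟩ := exists_denseRange_boundedContinuous Y
  have hmeas (g : Y →ᵇ ℝ≥0) (j : ℕ) : Measurable fun x => ∫⁻ y, g y ∂(κ j x) :=
    g.continuous.measurable.coe_nnreal_ennreal.lintegral_kernel
  have hle (g : Y →ᵇ ℝ≥0) (j : ℕ) (x : Ω) :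
      ∫⁻ y, g y ∂(κ j x) ≤ nndist g 0 * κ j x Set.univ := by
    rw [← lintegral_const]
    refine lintegral_mono fun y => ?_
    have h := nndist_coe_le_nndist (f := g) (g := 0) y
    rw [coe_zero, Pi.zero_apply, NNReal.nndist_zero_eq_val'] at h
    exact ENNReal.coe_le_coe.2 h
  have hfin (g : Y →ᵇ ℝ≥0) (j : ℕ) (x : Ω) : ∫⁻ y, g y ∂(κ j x) ≠ ∞ :=
    ne_top_of_le_ne_top (ENNReal.mul_ne_top ENNReal.coe_ne_top (measure_ne_top _ _)) (hle g j x)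
  obtain ⟨a, ha, hae⟩ := exists_tailWeights_tendsto_ae
    (m := ((Measure.count : Measure ℕ).prod μ).toFinite)
    (f := fun j p => (∫⁻ y, G p.1 y ∂(κ j p.2)).toNNReal)
    (fun j => measurable_from_prod_countable_right fun k => (hmeas (G k) j).ennreal_toNNReal)
  rw [ae_toFinite] at hae
  have hae' : ∀ᵐ x ∂μ, ∀ k, ∃ L : ℝ≥0∞, Tendsto (fun n =>
      ∑ j ∈ (a n).support, (a n j : ℝ≥0∞) * ∫⁻ y, G k y ∂(κ j x)) atTop (nhds L) := by
    refine ae_all_iff.2 fun k => ?_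
    filter_upwards [Measure.ae_count_iff.1 (Measure.ae_ae_of_ae_prod hae) k] with x ⟨L, hL⟩
    refine ⟨L, hL.congr fun n => ?_⟩
    rw [linearCombination_nnreal_apply, ENNReal.ofNNReal_finsetSum]
    exact Finset.sum_congr rfl fun j _ => by rw [ENNReal.coe_mul, ENNReal.coe_toNNReal (hfin _ _ _)]
  have hlt : ∀ᵐ x ∂μ, ∀ k, liminf (fun n =>
      ∑ j ∈ (a n).support, (a n j : ℝ≥0∞) * ∫⁻ y, G k y ∂(κ j x)) atTop < ∞ := by
    refine ae_all_iff.2 fun k => ?_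
    refine ae_lt_top (Measurable.liminf fun n =>
      Finset.measurable_sum _ fun j _ => (hmeas (G k) j).const_mul _) ?_
    refine ne_top_of_le_ne_top (ENNReal.mul_ne_top (ENNReal.coe_ne_top (r := nndist (G k) 0)) hC)
      (lintegral_liminf_tailWeights_le ha (hmeas (G k)) fun j => ?_)
    calc ∫⁻ x, ∫⁻ y, G k y ∂(κ j x) ∂μ ≤ ∫⁻ x, nndist (G k) 0 * κ j x Set.univ ∂μ :=
          lintegral_mono fun x => hle _ _ _
      _ ≤ nndist (G k) 0 * C := by
          rw [lintegral_const_mul _ ((κ j).measurable_coe .univ)]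
          gcongr
          exact hκC j
  obtain ⟨t, htμ, htm, ht⟩ := (hae'.and hlt).exists_measurable_mem
  have hsum (g : Y →ᵇ ℝ≥0) (n : ℕ) (x : Ω) :
      ∑ j ∈ (a n).support, (a n j : ℝ≥0∞) * ∫⁻ y, g y ∂(κ j x)
        = ∫⁻ y, g y ∂(∑ j ∈ (a n).support, (a n j : ℝ≥0∞) • κ j x) :=
    (lintegral_sum_smul_measure _ _ _ _).symm
  have hex (x : Ω) : ∃ M' : FiniteMeasure Y, ∀ g : Y →ᵇ ℝ≥0, Tendsto (fun n => t.indicator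
      (fun x => ∑ j ∈ (a n).support, (a n j : ℝ≥0∞) * ∫⁻ y, g y ∂(κ j x)) x) atTop
        (nhds (∫⁻ y, g y ∂(M' : Measure Y))) := by
    by_cases hx : x ∈ t
    · let M : ℕ → FiniteMeasure Y := fun n => ⟨∑ j ∈ (a n).support, (a n j : ℝ≥0∞) • κ j x,
        isFiniteMeasure_sum_smul _ _ _⟩
      obtain ⟨M', hM'⟩ := exists_tendsto_finiteMeasure_of_denseRange hG (M := M) fun k => by
        obtain ⟨L, hL⟩ := (ht x hx).1 k
        have hLtop : L < ∞ := hL.liminf_eq ▸ (ht x hx).2 k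
        lift L to ℝ≥0 using hLtop.ne
        refine ⟨L, ENNReal.tendsto_coe.1 (hL.congr fun n => ?_)⟩
        rw [hsum, FiniteMeasure.testAgainstNN_coe_eq]
        rfl
      refine ⟨M', fun g => ?_⟩
      simp only [Set.indicator_of_mem hx, hsum]
      exact FiniteMeasure.tendsto_iff_forall_lintegral_tendsto.1 hM' g
    · exact ⟨0, fun g => by simp [Set.indicator_of_notMem hx]⟩
  choose M' hM' using hex
  refine ⟨a, ha, ⟨fun x => (M' x : Measure Y),
    measurable_of_measurable_lintegral_boundedContinuous fun g => ?_⟩, fun x => ?_, ?_⟩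
  · exact ENNReal.measurable_of_tendsto (fun n => (Finset.measurable_sum _ fun j _ =>
      (hmeas g j).const_mul _).indicator htm) (tendsto_pi_nhds.2 fun x => hM' x g)
  · exact inferInstanceAs (IsFiniteMeasure (M' x : Measure Y))
  · filter_upwards [htμ] with x hx g
    have h := hM' x g
    simp only [Set.indicator_of_mem hx] at h
    exact h

end

/-- **Compactness of `Q(μ, ≤ν)`.** Given kernels `qₙ` transporting `μ` to measures `ρₙ ≤ ν`
with `ν` compactly supported, there are finite convex combinations `rₙ` of `{q_j : j ≥ n}`
and a kernel `r` transporting `μ` to some `ρ ≤ ν` with `rₙ^x → r^x` weakly `μ`-a.e. -/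
theorem kernel_compactness {d : ℕ}
    (μ ν : Measure (Ed d)) [IsFiniteMeasure μ] [IsFiniteMeasure ν]
    (hμ1 : Integrable (fun x => ‖x‖) μ) (hν1 : Integrable (fun x => ‖x‖) ν)
    (hνK : ∃ K : Set (Ed d), IsCompact K ∧ ν Kᶜ = 0)
    (q : ℕ → Ed d → Measure (Ed d)) (hq : ∀ n, IsUKernel (q n))
    (hqt : ∀ n, ∃ ρ : Measure (Ed d), ρ ≤ ν ∧ Transports (q n) μ ρ) :
    ∃ (s : ℕ → Finset ℕ) (w : ℕ → ℕ → ℝ≥0) (r : ℕ → Ed d → Measure (Ed d))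
      (rl : Ed d → Measure (Ed d)),
      (∀ n, ∀ j ∈ s n, n ≤ j) ∧
      (∀ n, ∑ j ∈ s n, w n j = 1) ∧
      (∀ n x, r n x = ∑ j ∈ s n, (w n j : ℝ≥0∞) • q j x) ∧
      IsUKernel rl ∧
      (∃ ρ : Measure (Ed d), ρ ≤ ν ∧ Transports rl μ ρ) ∧
      (∀ᵐ x ∂μ, ∀ g : Ed d → ℝ, Continuous g → (∃ C : ℝ, ∀ y, |g y| ≤ C) →
        Filter.Tendsto (fun n => ∫ y, g y ∂(r n x)) Filter.atTop
          (nhds (∫ y, g y ∂(rl x)))) := by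
  obtain ⟨K, hK, hνK⟩ := hνK
  have : CompactSpace K := isCompact_iff_compactSpace.1 hK
  have hKm : MeasurableSet K := hK.measurableSet
  have hqm n : Measurable (q n) := Measure.measurable_of_measurable_coe _ (hq n).2
  have hqν n : μ.bind (q n) ≤ ν := by
    obtain ⟨ρ, hρ, hqρ⟩ := hqt n
    refine Measure.le_iff.2 fun A hA => ?_
    rw [Measure.bind_apply hA (hqm n).aemeasurable, hqρ A hA]
    exact hρ A
  have hqK : ∀ᵐ x ∂μ, ∀ n, (q n x).restrict K = q n x := by
    refine ae_all_iff.2 fun n => ?_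
    have h0 : μ.bind (q n) Kᶜ = 0 := le_antisymm ((hqν n _).trans hνK.le) zero_le
    rw [Measure.bind_apply hKm.compl (hqm n).aemeasurable,
      lintegral_eq_zero_iff ((hq n).2 _ hKm.compl)] at h0
    filter_upwards [h0] with x hx
    exact Measure.restrict_eq_self_of_ae_mem hx
  let κ : ℕ → ProbabilityTheory.Kernel (Ed d) K := fun n =>
    ProbabilityTheory.Kernel.comapRight ⟨q n, hqm n⟩ (MeasurableEmbedding.subtype_coe hKm)
  have hκmap n x : (κ n x).map Subtype.val = (q n x).restrict K := map_comap_subtype_coe hKm _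
  have hκint n x (g : Ed d → ℝ≥0∞) : ∫⁻ y, g y ∂(κ n x) = ∫⁻ y in K, g y ∂(q n x) := by
    rw [← hκmap, (MeasurableEmbedding.subtype_coe hKm).lintegral_map]
  have hκuniv n x : κ n x Set.univ = q n x K := by simpa using hκint n x 1
  have hκfin n x : IsFiniteMeasure (κ n x) := by
    have := (hq n).1 x
    exact ⟨hκuniv n x ▸ measure_lt_top _ _⟩
  obtain ⟨a, ha, η, hη, hlim⟩ := exists_tailWeights_tendsto_kernel (μ := μ) hκfin
    (measure_ne_top ν K) fun n => by
      simp only [hκuniv]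
      rw [← Measure.bind_apply hKm (hqm n).aemeasurable]
      exact hqν n K
  have hrm : Measurable fun x => (η x).map (Subtype.val : K → Ed d) :=
    (Measure.measurable_map _ measurable_subtype_coe).comp η.measurable
  have hlim' : ∀ᵐ x ∂μ, ∀ g : BoundedContinuousFunction (Ed d) ℝ≥0,
      Tendsto (fun n => ∑ j ∈ (a n).support, (a n j : ℝ≥0∞) * ∫⁻ y, g y ∂(q j x)) atTop
        (nhds (∫⁻ y, g y ∂((η x).map (Subtype.val : K → Ed d)))) := by
    filter_upwards [hlim, hqK] with x hx hxK g
    rw [(MeasurableEmbedding.subtype_coe hKm).lintegral_map]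
    refine (hx (g.compContinuous ⟨Subtype.val, continuous_subtype_val⟩)).congr fun n => ?_
    refine Finset.sum_congr rfl fun j _ => ?_
    have h := hκint j x fun y => g y
    rw [hxK j] at h
    rw [← h]
    rfl
  refine ⟨fun n => (a n).support, fun n => a n,
    fun n x => ∑ j ∈ (a n).support, (a n j : ℝ≥0∞) • q j x,
    fun x => (η x).map (Subtype.val : K → Ed d), fun n j hj => (ha n).1 hj,
    fun n => sum_tailWeights (ha n), fun _ _ => rfl,
    ⟨fun x => Measure.isFiniteMeasure_map _ _, fun A hA => (Measure.measurable_coe hA).comp hrm⟩,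
    ⟨μ.bind fun x => (η x).map (Subtype.val : K → Ed d), ?_,
      fun A hA => (Measure.bind_apply hA hrm.aemeasurable).symm⟩, ?_⟩
  · refine measure_le_of_lintegral_boundedContinuous_le fun g => ?_
    have hgm : Measurable fun y => (g y : ℝ≥0∞) := g.continuous.measurable.coe_nnreal_ennreal
    rw [Measure.lintegral_bind hrm.aemeasurable hgm.aemeasurable]
    refine (lintegral_congr_ae ?_).trans_le (lintegral_liminf_tailWeights_le ha
      (fun j => (Measure.measurable_lintegral hgm).comp (hqm j)) fun j => ?_)
    · filter_upwards [hlim'] with x hx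
      exact (hx g).liminf_eq.symm
    · refine le_trans (le_of_eq ?_) (lintegral_mono' (hqν j) le_rfl)
      exact (Measure.lintegral_bind (hqm j).aemeasurable hgm.aemeasurable).symm
  · filter_upwards [hlim'] with x hx g hg ⟨C, hC⟩
    have hqfin j := (hq j).1 x
    let M : ℕ → FiniteMeasure (Ed d) := fun n =>
      ⟨∑ j ∈ (a n).support, (a n j : ℝ≥0∞) • q j x, isFiniteMeasure_sum_smul _ _ _⟩
    let M' : FiniteMeasure (Ed d) :=
      ⟨(η x).map (Subtype.val : K → Ed d), Measure.isFiniteMeasure_map _ _⟩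
    have hM : Tendsto M atTop (nhds M') := by
      refine FiniteMeasure.tendsto_iff_forall_lintegral_tendsto.2 fun g =>
        (hx g).congr fun n => ?_
      exact (lintegral_sum_smul_measure _ _ _ _).symm
    exact FiniteMeasure.tendsto_iff_forall_integral_tendsto.1 hM
      (BoundedContinuousFunction.ofNormedAddCommGroup g hg C hC)
end
end

section
/- Let μ and ν be finite nonnegative Borel measures on ℝ^d with finite first moments, and suppose ν has compact support. If BarC(μ,ν) = 0, then Q_m(μ,ν) ≠ ∅, i.e. there exists a moment-preserving unnormalized kernel transporting μ to ν. -/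
open MeasureTheory Filter
open scoped ENNReal NNReal

noncomputable section

/-- The barycentric cost `BarC(μ,ν) = inf_{q ∈ Q(μ,ν)} ∫ |x − ba(q^x)| μ(dx)`. -/
def BarC {d : ℕ} (μ ν : Measure (Ed d)) : ℝ≥0∞ :=
  ⨅ (q : Ed d → Measure (Ed d)) (_ : IsUKernel q ∧ Transports q μ ν),
    ∫⁻ x, (‖x - ∫ y, y ∂(q x)‖₊ : ℝ≥0∞) ∂μ

open ProbabilityTheory in
/-- A kernel all of whose values are finite measures is s-finite. -/
lemma isSFiniteKernel_of_forall_isFiniteMeasure {α β : Type*} {mα : MeasurableSpace α}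
    {mβ : MeasurableSpace β} (κ : Kernel α β) (hκ : ∀ a, IsFiniteMeasure (κ a)) :
    IsSFiniteKernel κ := by
  classical
  have hmeas : Measurable fun a => ⌊(κ a Set.univ).toNNReal⌋₊ :=
    Nat.measurable_floor.comp (κ.measurable_coe MeasurableSet.univ).ennreal_toNNReal
  have hs (n : ℕ) : MeasurableSet {a | ⌊(κ a Set.univ).toNNReal⌋₊ = n} :=
    hmeas (measurableSet_singleton n)
  refine ⟨⟨fun n => Kernel.piecewise (hs n) κ 0, fun n => ?_, ?_⟩⟩
  · refine ⟨⟨(n + 1 : ℝ≥0), by exact_mod_cast ENNReal.coe_lt_top, fun a => ?_⟩⟩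
    rw [Kernel.piecewise_apply]
    split_ifs with h
    · have h1 : (κ a Set.univ).toNNReal < n + 1 := by
        have h : ⌊(κ a Set.univ).toNNReal⌋₊ = n := h
        exact h ▸ Nat.lt_floor_add_one _
      rw [← ENNReal.coe_toNNReal (measure_ne_top (κ a) Set.univ)]
      exact_mod_cast h1.le
    · simp
  · ext a s hsm
    rw [Kernel.sum_apply' _ _ hsm, tsum_eq_single ⌊(κ a Set.univ).toNNReal⌋₊]
    · simp [Kernel.piecewise_apply]
    · intro n hn
      simp [Kernel.piecewise_apply, hn.symm]

/-- Set integrals over preimages of closed sets are limits of integrals against the outer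
approximating sequence. -/
lemma tendsto_integral_apprSeq_comp_smul {X γ F : Type*}
    [TopologicalSpace X] [HasOuterApproxClosed X] [MeasurableSpace X] [BorelSpace X]
    {mγ : MeasurableSpace γ} [NormedAddCommGroup F] [NormedSpace ℝ F]
    {P : Measure γ} {χ : γ → X} (hχ : Measurable χ) {k : γ → F} (hk : Integrable k P)
    {C : Set X} (hC : IsClosed C) :
    Tendsto (fun n => ∫ a, ((hC.apprSeq n (χ a) : ℝ≥0) : ℝ) • k a ∂P) atTop
      (nhds (∫ a in χ ⁻¹' C, k a ∂P)) := by
  rw [← integral_indicator (hχ hC.measurableSet)]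
  refine tendsto_integral_of_dominated_convergence (fun a => ‖k a‖) (fun n => ?_) hk.norm
    (fun n => ae_of_all _ fun a => ?_) (ae_of_all _ fun a => ?_)
  · have : Measurable fun a => ((hC.apprSeq n (χ a) : ℝ≥0) : ℝ) :=
      ((NNReal.continuous_coe.comp (hC.apprSeq n).continuous).measurable).comp hχ
    exact this.aestronglyMeasurable.smul hk.1
  · rw [norm_smul]
    refine mul_le_of_le_one_left (norm_nonneg _) ?_
    simpa using HasOuterApproxClosed.apprSeq_apply_le_one hC n (χ a)
  · have h1 := tendsto_pi_nhds.1 (HasOuterApproxClosed.tendsto_apprSeq hC) (χ a)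
    have h2 := ((NNReal.continuous_coe.tendsto _).comp h1).smul_const (k a)
    convert! h2 using 2
    by_cases hm : χ a ∈ C <;> simp [Set.indicator, hm]

/-- Two vector measures given as images of densities agree on Borel sets as soon as they agree
against continuous functions bounded by one. -/
lemma setIntegral_preimage_eq_of_forall_continuous {X α β F : Type*}
    [TopologicalSpace X] [HasOuterApproxClosed X] [MeasurableSpace X] [BorelSpace X]
    {mα : MeasurableSpace α} {mβ : MeasurableSpace β}
    [NormedAddCommGroup F] [NormedSpace ℝ F]
    {P : Measure α} {Q : Measure β} {φ : α → X} {ψ : β → X}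
    (hφ : Measurable φ) (hψ : Measurable ψ) {f : α → F} {h : β → F}
    (hf : Integrable f P) (hh : Integrable h Q)
    (heq : ∀ g : X → ℝ, Continuous g → (∀ x, |g x| ≤ 1) →
      ∫ a, g (φ a) • f a ∂P = ∫ b, g (ψ b) • h b ∂Q)
    {A : Set X} (hA : MeasurableSet A) :
    ∫ a in φ ⁻¹' A, f a ∂P = ∫ b in ψ ⁻¹' A, h b ∂Q := by
  have huniv : ∫ a, f a ∂P = ∫ b, h b ∂Q := by
    simpa using heq (fun _ => 1) continuous_const (by simp)
  induction A, hA using MeasurableSpace.induction_on_inter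
    (h_eq := (BorelSpace.measurable_eq (α := X)).trans borel_eq_generateFrom_isClosed)
    (isPiSystem_isClosed) with
  | empty => simp
  | basic C hC =>
    have hC : IsClosed C := hC
    refine tendsto_nhds_unique (tendsto_integral_apprSeq_comp_smul hφ hf hC) ?_
    have e (n : ℕ) := heq (fun x => ((hC.apprSeq n x : ℝ≥0) : ℝ))
      (NNReal.continuous_coe.comp (hC.apprSeq n).continuous) (fun x => by
        simpa using HasOuterApproxClosed.apprSeq_apply_le_one hC n x)
    simp_rw [e]
    exact tendsto_integral_apprSeq_comp_smul hψ hh hC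
  | compl t ht ih =>
    rw [Set.preimage_compl, Set.preimage_compl, setIntegral_compl (hφ ht) hf,
      setIntegral_compl (hψ ht) hh, ih, huniv]
  | iUnion t hd ht ih =>
    rw [Set.preimage_iUnion, Set.preimage_iUnion,
      integral_iUnion (fun n => hφ (ht n)) (fun i j hij => (hd hij).preimage φ) hf.integrableOn,
      integral_iUnion (fun n => hψ (ht n)) (fun i j hij => (hd hij).preimage ψ) hh.integrableOn]
    exact tsum_congr ih

open ProbabilityTheory in
/-- A coupling with absolutely continuous first marginal and the right barycenters, together with
a centered remainder, yields a moment-preserving kernel. -/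
lemma exists_momentPreserving_of_coupling {d : ℕ} {μ ν κ : Measure (Ed d)}
    {π : Measure (Ed d × Ed d)} [IsFiniteMeasure μ] [IsFiniteMeasure κ] [IsFiniteMeasure π]
    (hμ : μ ≠ 0) (hμ1 : Integrable (fun x => x) μ) (hac : π.fst ≪ μ)
    (hsum : π.snd + κ = ν) (hπ1 : Integrable (fun p : Ed d × Ed d => p.2) π)
    (hκ1 : Integrable (fun y => y) κ) (hκ0 : ∫ y, y ∂κ = 0)
    (hbar : ∀ A : Set (Ed d), MeasurableSet A →
      ∫ p in Prod.fst ⁻¹' A, p.2 ∂π = ∫ x in A, x ∂μ) :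
    ∃ q : Ed d → Measure (Ed d),
      IsUKernel q ∧ Transports q μ ν ∧ MomentPreserving q μ := by
  set r := π.condKernel
  set ρ : Ed d → ℝ≥0 := fun x => (π.fst.rnDeriv μ x).toNNReal
  have hρm : Measurable ρ := (Measure.measurable_rnDeriv _ _).ennreal_toNNReal
  have hdens : μ.withDensity (fun x => (ρ x : ℝ≥0∞)) = π.fst := by
    rw [← Measure.withDensity_rnDeriv_eq _ _ hac]
    refine withDensity_congr_ae ?_
    filter_upwards [Measure.rnDeriv_lt_top π.fst μ] with x hx
    exact ENNReal.coe_toNNReal hx.ne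
  have hdis : π.fst ⊗ₘ r = π := π.disintegrate r
  set c : ℝ≥0 := (μ Set.univ).toNNReal⁻¹ with hc
  have hμu : (μ Set.univ).toNNReal ≠ 0 := by
    simp [ENNReal.toNNReal_eq_zero_iff, hμ, measure_ne_top]
  have hcμ : (c : ℝ≥0∞) * μ Set.univ = 1 := by
    rw [hc, ENNReal.coe_inv hμu, ENNReal.coe_toNNReal (measure_ne_top _ _)]
    exact ENNReal.inv_mul_cancel (by simpa using hμ) (measure_ne_top _ _)
  have hrm {B : Set (Ed d)} (hB : MeasurableSet B) : Measurable fun x => r x B :=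
    r.measurable_coe hB
  refine ⟨fun x => ρ x • r x + c • κ, ⟨fun x => inferInstance, fun A hA => ?_⟩, fun A hA => ?_, ?_⟩
  · simp only [Measure.add_apply, Measure.smul_apply, ENNReal.smul_def, smul_eq_mul]
    exact (hρm.coe_nnreal_ennreal.mul (hrm hA)).add_const _
  · simp only [Measure.add_apply, Measure.smul_apply, ENNReal.smul_def, smul_eq_mul]
    rw [lintegral_add_right _ measurable_const, lintegral_const, ← hsum, Measure.add_apply,
      mul_right_comm, hcμ, one_mul]
    congr 1
    have h1 := lintegral_withDensity_eq_lintegral_mul μ hρm.coe_nnreal_ennreal (hrm hA)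
    simp only [Pi.mul_apply] at h1
    rw [← h1, hdens, Measure.snd_apply hA, ← Set.univ_prod]
    nth_rw 2 [← hdis]
    rw [Measure.compProd_apply_prod MeasurableSet.univ hA, Measure.restrict_univ]
  · have hint : Integrable (fun p : Ed d × Ed d => p.2) (π.fst ⊗ₘ r) := by rwa [hdis]
    have hbint : Integrable (fun x => ∫ y, y ∂(r x)) π.fst := by
      simpa using hint.integral_compProd
    have hb : Integrable (fun x => ρ x • ∫ y, y ∂(r x)) μ := by
      rw [← integrable_withDensity_iff_integrable_smul hρm, hdens]
      exact hbint
    have hae : (fun x => ρ x • ∫ y, y ∂(r x)) =ᵐ[μ] fun x => x := by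
      refine Integrable.ae_eq_of_forall_setIntegral_eq _ _ hb hμ1 fun A hA _ => ?_
      rw [← setIntegral_withDensity_eq_setIntegral_smul hρm _ hA, hdens, ← hbar A hA,
        ← Set.prod_univ]
      nth_rw 2 [← hdis]
      rw [Measure.setIntegral_compProd hA MeasurableSet.univ hint.integrableOn]
      simp
    have hri : ∀ᵐ x ∂μ, (ρ x : ℝ≥0∞) ≠ 0 → Integrable (fun y => y) (r x) := by
      rw [← ae_withDensity_iff hρm.coe_nnreal_ennreal, hdens]
      exact ((Measure.integrable_compProd_iff hint.1).1 hint).1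
    filter_upwards [hae, hri] with x hx hxi
    have hi : Integrable (fun y => y) (ρ x • r x) := by
      by_cases h0 : ρ x = 0
      · simp [h0]
      · exact (hxi (by simpa using h0)).smul_measure_nnreal
    rw [integral_add_measure hi hκ1.smul_measure_nnreal, integral_smul_nnreal_measure,
      integral_smul_nnreal_measure, hκ0, smul_zero, add_zero]
    exact hx

/-- Integrability in the second variable only depends on the second marginal. -/
lemma integrable_snd_of_snd_eq {d : ℕ} {ν : Measure (Ed d)} {P : Measure (Ed d × Ed d)}
    (hP : P.snd = ν) (hν1 : Integrable (fun y => y) ν) :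
    Integrable (fun p : Ed d × Ed d => p.2) P := by
  subst hP
  exact hν1.comp_measurable measurable_snd

/-- Multiplying an integrable function by a measurable function bounded by one preserves
integrability. -/
lemma integrable_comp_smul_of_abs_le_one {α X F : Type*} {mα : MeasurableSpace α}
    [MeasurableSpace X] [NormedAddCommGroup F] [NormedSpace ℝ F] {w : X → ℝ} (hw : Measurable w)
    (hw1 : ∀ x, |w x| ≤ 1) {P : Measure α} {φ : α → X} (hφ : Measurable φ) {f : α → F}
    (hf : Integrable f P) : Integrable (fun a => w (φ a) • f a) P :=
  hf.bdd_smul 1 (hw.comp hφ).aestronglyMeasurable (ae_of_all _ fun _ => hw1 _)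

open ProbabilityTheory in
/-- A transporting kernel induces a coupling-type measure whose barycenters are controlled by the
barycentric cost of the kernel. -/
lemma exists_coupling_enorm_sub_le {d : ℕ} {μ ν : Measure (Ed d)} [IsFiniteMeasure μ]
    (hμ1 : Integrable (fun x => x) μ) (hν1 : Integrable (fun y => y) ν)
    {q : Ed d → Measure (Ed d)} (hq : IsUKernel q) (hT : Transports q μ ν) :
    ∃ P : Measure (Ed d × Ed d), P.snd = ν ∧ ∀ w : Ed d → ℝ, Measurable w → (∀ x, |w x| ≤ 1) →
      ‖∫ p, w p.1 • p.2 ∂P - ∫ x, w x • x ∂μ‖ₑ ≤ ∫⁻ x, (‖x - ∫ y, y ∂(q x)‖₊ : ℝ≥0∞) ∂μ := by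
  let κ : Kernel (Ed d) (Ed d) := ⟨q, Measure.measurable_of_measurable_coe _ hq.2⟩
  have hκ : IsSFiniteKernel κ := isSFiniteKernel_of_forall_isFiniteMeasure κ hq.1
  have hsnd : (μ ⊗ₘ κ).snd = ν := by
    ext A hA
    rw [Measure.snd_apply hA, ← Set.univ_prod, Measure.compProd_apply_prod MeasurableSet.univ hA,
      Measure.restrict_univ]
    exact hT A hA
  have hint := integrable_snd_of_snd_eq hsnd hν1
  have hb : Integrable (fun x => ∫ y, y ∂(q x)) μ := by
    simpa using! hint.integral_compProd
  refine ⟨μ ⊗ₘ κ, hsnd, fun w hw hw1 => ?_⟩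
  have hdis : ∫ p, w p.1 • p.2 ∂(μ ⊗ₘ κ) = ∫ x, w x • ∫ y, y ∂(q x) ∂μ :=
    (Measure.integral_compProd (integrable_comp_smul_of_abs_le_one hw hw1 measurable_fst hint)).trans
      (integral_congr_ae (ae_of_all _ fun x => integral_smul (w x) _))
  have hsub : ∫ x, w x • ∫ y, y ∂(q x) ∂μ - ∫ x, w x • x ∂μ =
      ∫ x, (w x • ∫ y, y ∂(q x) - w x • x) ∂μ :=
    (integral_sub (integrable_comp_smul_of_abs_le_one hw hw1 measurable_id hb)
      (integrable_comp_smul_of_abs_le_one hw hw1 measurable_id hμ1)).symm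
  rw [hdis, hsub]
  refine (enorm_integral_le_lintegral_enorm _).trans (lintegral_mono fun x => ?_)
  rw [← smul_sub, enorm_smul, enorm_sub_rev]
  refine mul_le_of_le_one_left (by simp) ?_
  rw [← ofReal_norm]
  simpa using hw1 x

open OpenPartialHomeomorph in
/-- A weak limit, in the compactified first variable, of almost moment-preserving couplings. -/
lemma exists_limit_coupling {d : ℕ} {μ ν : Measure (Ed d)} [IsFiniteMeasure μ] [IsFiniteMeasure ν]
    (hμ1 : Integrable (fun x => x) μ) (hν1 : Integrable (fun y => y) ν)
    (hνK : ∃ K : Set (Ed d), IsCompact K ∧ ν Kᶜ = 0) (hbar : BarC μ ν = 0) :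
    ∃ π : Measure (Ed d × Ed d), π.snd = ν ∧ ∀ A : Set (Ed d), MeasurableSet A →
      ∫ p in Prod.fst ⁻¹' A, p.2 ∂π = ∫ x in univUnitBall ⁻¹' A, x ∂μ := by
  obtain ⟨K, hK, hKν⟩ := hνK
  set Φ : Ed d → Ed d := fun x => univUnitBall x
  have hΦc : Continuous Φ := by
    have := (univUnitBall (E := Ed d)).continuousOn
    rwa [univUnitBall_source, continuousOn_univ] at this
  have hΦb (x : Ed d) : Φ x ∈ Metric.closedBall (0 : Ed d) 1 :=
    Metric.ball_subset_closedBall ((univUnitBall (E := Ed d)).map_source (Set.mem_univ x))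
  have hP (n : ℕ) : ∃ P : Measure (Ed d × Ed d), P.snd = ν ∧
      ∀ w : Ed d → ℝ, Measurable w → (∀ x, |w x| ≤ 1) →
        ‖∫ p, w p.1 • p.2 ∂P - ∫ x, w x • x ∂μ‖ₑ ≤ (n : ℝ≥0∞)⁻¹ := by
    have h : BarC μ ν < (n : ℝ≥0∞)⁻¹ := by simp [hbar]
    obtain ⟨q, h⟩ := iInf_lt_iff.1 h
    obtain ⟨hq, h⟩ := iInf_lt_iff.1 h
    obtain ⟨P, hP, hw⟩ := exists_coupling_enorm_sub_le hμ1 hν1 hq.1 hq.2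
    exact ⟨P, hP, fun w hwm hw1 => (hw w hwm hw1).trans h.le⟩
  choose P hPsnd hPw using hP
  have hmap : Measurable (Prod.map Φ (id : Ed d → Ed d)) := hΦc.measurable.prodMap measurable_id
  have hsnd (n : ℕ) : ((P n).map (Prod.map Φ id)).snd = ν := by
    rw [← hPsnd n, Measure.snd, Measure.map_map measurable_snd hmap]
    rfl
  have hfin {Q : Measure (Ed d × Ed d)} (hQ : Q.snd = ν) : IsFiniteMeasure Q :=
    ⟨by rw [← Measure.snd_univ, hQ]; exact measure_lt_top _ _⟩
  have hmemK {Q : Measure (Ed d × Ed d)} (hQ : Q.snd = ν) : ∀ᵐ p ∂Q, p.2 ∈ K := by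
    have : ∀ᵐ y ∂(Q.map Prod.snd), y ∈ K := by
      change ∀ᵐ y ∂Q.snd, y ∈ K
      rw [hQ]
      exact hKν
    exact ae_of_ae_map measurable_snd.aemeasurable this
  let πs (n : ℕ) : FiniteMeasure (Ed d × Ed d) := ⟨(P n).map (Prod.map Φ id), hfin (hsnd n)⟩
  have hcomp := isCompact_setOfPred_finiteMeasure_le_of_isCompact (ν Set.univ).toNNReal
    ((isCompact_closedBall (0 : Ed d) 1).prod hK)
  have hπs (n : ℕ) : (πs n).mass ≤ (ν Set.univ).toNNReal ∧
      πs n (Metric.closedBall (0 : Ed d) 1 ×ˢ K)ᶜ = 0 := by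
    constructor
    · refine le_of_eq (congrArg ENNReal.toNNReal ?_)
      change (P n).map (Prod.map Φ id) Set.univ = _
      rw [← Measure.snd_univ, hsnd]
    · refine (FiniteMeasure.null_iff_toMeasure_null _ _).2 ?_
      have h : ∀ᵐ p ∂((P n).map (Prod.map Φ id)), p ∈ Metric.closedBall (0 : Ed d) 1 ×ˢ K := by
        refine (ae_map_iff hmap.aemeasurable
          (Metric.isClosed_closedBall.prod hK.isClosed).measurableSet).2 ?_
        filter_upwards [hmemK (hPsnd n)] with p hp
        exact ⟨hΦb p.1, hp⟩
      exact h
  obtain ⟨π, -, hπ⟩ := hcomp.ultrafilter_le_nhds ((hyperfilter ℕ).map πs)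
    (by
      rw [le_principal_iff]
      exact Filter.mem_map.2 (Eventually.of_forall hπs))
  have hlim : Tendsto πs (hyperfilter ℕ) (nhds π) := hπ
  have hπsnd : (π : Measure (Ed d × Ed d)).snd = ν := by
    have h1 := FiniteMeasure.tendsto_map_of_tendsto_of_continuous _ _ hlim continuous_snd
    have h2 (n : ℕ) : (πs n).map Prod.snd = (⟨ν, inferInstance⟩ : FiniteMeasure (Ed d)) :=
      Subtype.ext (hsnd n)
    simp_rw [h2] at h1
    have h3 : π.map Prod.snd = (⟨ν, inferInstance⟩ : FiniteMeasure (Ed d)) :=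
      tendsto_nhds_unique h1 tendsto_const_nhds
    exact congrArg Subtype.val h3
  refine ⟨π, hπsnd, fun A hA => ?_⟩
  have hπint := integrable_snd_of_snd_eq hπsnd hν1
  refine setIntegral_preimage_eq_of_forall_continuous measurable_fst hΦc.measurable hπint hμ1
    (fun g hg hg1 => ?_) hA
  obtain ⟨R, hR⟩ := hK.isBounded.subset_closedBall (0 : Ed d)
  have hclip {y : Ed d} (hy : y ∈ K) (i : Fin d) : max (-R) (min R (y i)) = y i := by
    have h1 : |y i| ≤ R := (PiLp.norm_apply_le y i).trans (by simpa using hR hy)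
    rw [min_eq_right (abs_le.1 h1).2, max_eq_right (abs_le.1 h1).1]
  have hcoord {α : Type} {mα : MeasurableSpace α} {Q : Measure α} {f : α → Ed d}
      (hf : Integrable f Q) (i : Fin d) : (∫ a, f a ∂Q) i = ∫ a, f a i ∂Q :=
    ((EuclideanSpace.proj (𝕜 := ℝ) i).integral_comp_comm hf).symm
  ext i
  let F : BoundedContinuousFunction (Ed d × Ed d) ℝ :=
    BoundedContinuousFunction.ofNormedAddCommGroup
      (fun p => g p.1 * max (-R) (min R (p.2 i))) (by fun_prop) |R| (fun p => by
        rw [norm_mul]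
        refine (mul_le_of_le_one_left (norm_nonneg _) (hg1 _)).trans ?_
        exact abs_le.2 ⟨(neg_le_neg (le_abs_self R)).trans (le_max_left _ _),
          max_le (neg_le_abs R) ((min_le_left _ _).trans (le_abs_self R))⟩)
  have hF {Q : Measure (Ed d × Ed d)} (hQ : Q.snd = ν) :
      ∫ p, F p ∂Q = ∫ p, (g p.1 • p.2) i ∂Q := by
    refine integral_congr_ae ?_
    filter_upwards [hmemK hQ] with p hp
    simp [F, hclip hp]
  have h1 := FiniteMeasure.tendsto_iff_forall_integral_tendsto.1 hlim F
  rw [hF hπsnd, ← hcoord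
    (integrable_comp_smul_of_abs_le_one hg.measurable hg1 measurable_fst hπint)] at h1
  have h2 (n : ℕ) : ∫ p, F p ∂(πs n : Measure (Ed d × Ed d)) =
      (∫ p, g (Φ p.1) • p.2 ∂(P n)) i := by
    refine (hF (hsnd n)).trans ?_
    refine (integral_map hmap.aemeasurable
      (Measurable.aestronglyMeasurable (by fun_prop))).trans ?_
    exact (hcoord (integrable_comp_smul_of_abs_le_one hg.measurable hg1
      (hΦc.measurable.comp measurable_fst) (integrable_snd_of_snd_eq (hPsnd n) hν1)) i).symm
  simp_rw [h2] at h1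
  refine tendsto_nhds_unique h1 (Tendsto.mono_left ?_ Nat.hyperfilter_le_atTop)
  refine ((EuclideanSpace.proj (𝕜 := ℝ) i).continuous.tendsto _).comp ?_
  rw [tendsto_iff_edist_tendsto_0]
  refine tendsto_of_tendsto_of_tendsto_of_le_of_le tendsto_const_nhds
    ENNReal.tendsto_inv_nat_nhds_zero (fun n => zero_le) (fun n => ?_)
  rw [edist_eq_enorm_sub]
  exact hPw n (fun x => g (Φ x)) (hg.comp hΦc).measurable (fun x => hg1 _)

/-- If `ν` is compactly supported and `BarC(μ,ν) = 0`, then there is a moment-preserving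
unnormalized kernel transporting `μ` to `ν`. -/
theorem exists_momentPreserving_of_barC_eq_zero {d : ℕ}
    (μ ν : Measure (Ed d)) [IsFiniteMeasure μ] [IsFiniteMeasure ν]
    (hμ1 : Integrable (fun x => ‖x‖) μ) (hν1 : Integrable (fun x => ‖x‖) ν)
    (hνK : ∃ K : Set (Ed d), IsCompact K ∧ ν Kᶜ = 0)
    (hbar : BarC μ ν = 0) :
    ∃ q : Ed d → Measure (Ed d),
      IsUKernel q ∧ Transports q μ ν ∧ MomentPreserving q μ := by
  rcases eq_or_ne μ 0 with rfl | hμ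
  · obtain ⟨q, h⟩ := iInf_lt_iff.1 (hbar.trans_lt ENNReal.zero_lt_top)
    obtain ⟨hq, -⟩ := iInf_lt_iff.1 h
    exact ⟨q, hq.1, hq.2, by simp [MomentPreserving]⟩
  have hμ1' : Integrable (fun x => x) μ := (integrable_norm_iff (by fun_prop)).1 hμ1
  have hν1' : Integrable (fun x => x) ν := (integrable_norm_iff (by fun_prop)).1 hν1
  obtain ⟨π, hπsnd, hπ⟩ := exists_limit_coupling hμ1' hν1' hνK hbar
  have hπfin : IsFiniteMeasure π :=
    ⟨by rw [← Measure.snd_univ, hπsnd]; exact measure_lt_top _ _⟩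
  have hπint := integrable_snd_of_snd_eq hπsnd hν1'
  let Φ : Ed d → Ed d := fun x => OpenPartialHomeomorph.univUnitBall x
  let Ψ : Ed d → Ed d := fun u => OpenPartialHomeomorph.univUnitBall.symm u
  have hΦm : Measurable Φ := by
    simp only [Φ, OpenPartialHomeomorph.univUnitBall_apply]
    fun_prop
  have hΨm : Measurable Ψ := by
    simp only [Ψ, OpenPartialHomeomorph.univUnitBall_symm_apply]
    fun_prop
  have hΨΦ (x : Ed d) : Ψ (Φ x) = x :=
    OpenPartialHomeomorph.univUnitBall.left_inv (Set.mem_univ x)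
  have hmap : Measurable (Prod.map Ψ (id : Ed d → Ed d)) := hΨm.prodMap measurable_id
  -- `S` carries the part of the first marginal which is singular with respect to `μ.map Φ`.
  obtain ⟨S, hS, hS0, hSμ⟩ := Measure.mutuallySingular_singularPart π.fst (μ.map Φ)
  have hacS : π.fst.restrict S ≪ μ.map Φ := by
    rw [Measure.haveLebesgueDecomposition_add π.fst (μ.map Φ), Measure.restrict_add,
      Measure.restrict_eq_zero.2 hS0, zero_add]
    exact Measure.restrict_le_self.absolutelyContinuous.trans (withDensity_absolutelyContinuous _ _)
  rw [Measure.map_apply hΦm hS.compl] at hSμ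
  have hSf : MeasurableSet (Prod.fst ⁻¹' S : Set (Ed d × Ed d)) := measurable_fst hS
  refine exists_momentPreserving_of_coupling
    (π := (π.restrict (Prod.fst ⁻¹' S)).map (Prod.map Ψ id))
    (κ := (π.restrict (Prod.fst ⁻¹' S)ᶜ).snd) hμ hμ1' ?_ ?_ ?_ ?_ ?_ fun A hA => ?_
  · have h1 : ((π.restrict (Prod.fst ⁻¹' S)).map (Prod.map Ψ id)).fst =
        (π.fst.restrict S).map Ψ := by
      rw [Measure.fst, Measure.fst, Measure.map_map measurable_fst hmap,
        Measure.restrict_map measurable_fst hS, Measure.map_map hΨm measurable_fst]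
      rfl
    have h2 : (μ.map Φ).map Ψ = μ := by
      rw [Measure.map_map hΨm hΦm, show Ψ ∘ Φ = id from funext hΨΦ, Measure.map_id]
    rw [h1]
    exact h2 ▸ hacS.map hΨm
  · have h1 : ((π.restrict (Prod.fst ⁻¹' S)).map (Prod.map Ψ id)).snd =
        (π.restrict (Prod.fst ⁻¹' S)).snd := by
      rw [Measure.snd, Measure.map_map measurable_snd hmap]
      rfl
    rw [h1, Measure.snd, Measure.snd, ← Measure.map_add _ _ measurable_snd,
      Measure.restrict_add_restrict_compl hSf]
    exact hπsnd
  · rw [integrable_map_measure (by fun_prop) hmap.aemeasurable]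
    exact hπint.restrict
  · rw [Measure.snd, integrable_map_measure (by fun_prop) measurable_snd.aemeasurable]
    exact hπint.restrict
  · rw [Measure.snd, integral_map measurable_snd.aemeasurable (by fun_prop), ← Set.preimage_compl,
      hπ _ hS.compl]
    exact setIntegral_measure_zero _ hSμ
  · rw [setIntegral_map (measurable_fst hA) (by fun_prop) hmap.aemeasurable,
      Measure.restrict_restrict (hmap (measurable_fst hA))]
    refine (hπ (Ψ ⁻¹' A ∩ S) ((hΨm hA).inter hS)).trans (setIntegral_congr_set ?_)
    have hae : ∀ᵐ x ∂μ, Φ x ∈ S := by simpa [ae_iff] using! hSμ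
    filter_upwards [hae] with x hx
    refine propext ⟨fun h => ?_, fun h => ⟨?_, hx⟩⟩
    · have h' : Ψ (Φ x) ∈ A := h.1
      rwa [hΨΦ] at h'
    · change Ψ (Φ x) ∈ A
      rwa [hΨΦ]
end
end
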